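/- arXiv:1409.0120 — 2 statements merged into one kernel-verified Lean document; each statement's English description precedes it below -/
import Mathlib

section
/- In the setting of the weighted homogeneous pair (f,g), let h(z) = γ_1 z_1^{p(m−n)} + γ_2 z_2^{q(m−n)} with γ_1, γ_2 ∈ ℂ∖{0}, let t > 0 and F_t = fḡ + t·h. If the coefficients satisfy Re(conj(a_j)·b_j / conj(γ_j)) > 0 for j = 1 and j = 2, then every point w = (w_1, w_2) ∈ S_1(F_t) has w_1 ≠ 0 and w_2 ≠ 0. -/
open Complex

noncomputable section

/-- The Wirtinger derivative `∂P/∂z_j` at `w`, defined via the real Fréchet derivative: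
`∂P/∂z_j = (1/2)(∂P/∂x_j − i ∂P/∂y_j)`. -/
def wD {n : ℕ} (P : (Fin n → ℂ) → ℂ) (j : Fin n) (w : Fin n → ℂ) : ℂ :=
  (1 / 2 : ℂ) *
    (fderiv ℝ P w (Pi.single j 1) - Complex.I * fderiv ℝ P w (Pi.single j Complex.I))

/-- The Wirtinger derivative `∂P/∂z̄_j` at `w`:
`∂P/∂z̄_j = (1/2)(∂P/∂x_j + i ∂P/∂y_j)`. -/
def wDbar {n : ℕ} (P : (Fin n → ℂ) → ℂ) (j : Fin n) (w : Fin n → ℂ) : ℂ :=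
  (1 / 2 : ℂ) *
    (fderiv ℝ P w (Pi.single j 1) + Complex.I * fderiv ℝ P w (Pi.single j Complex.I))

/-- `P : ℂⁿ → ℂ` is a mixed polynomial: a finite sum `Σ c_{ν,μ} z^ν (conj z)^μ`. -/
def IsMixedPoly {n : ℕ} (P : (Fin n → ℂ) → ℂ) : Prop :=
  ∃ c : ((Fin n → ℕ) × (Fin n → ℕ)) →₀ ℂ, ∀ z : Fin n → ℂ,
    P z = c.sum fun νμ a =>
      a * (∏ j, z j ^ νμ.1 j) * ∏ j, (starRingEnd ℂ) (z j) ^ νμ.2 j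

/-- `w` is a singularity of `P` : the gradients (real differentials) of `Re P` and `Im P`
are linearly dependent at `w`. -/
def IsSingularity {n : ℕ} (P : (Fin n → ℂ) → ℂ) (w : Fin n → ℂ) : Prop :=
  ∃ a b : ℝ, ¬(a = 0 ∧ b = 0) ∧
    a • fderiv ℝ (fun z => (P z).re) w + b • fderiv ℝ (fun z => (P z).im) w = 0


/-- The rank at `w` of the real differential of `F : ℂⁿ → ℂ`, viewed as a smooth map
`ℝ^{2n} → ℝ²`. -/
def rankAt {n : ℕ} (F : (Fin n → ℂ) → ℂ) (w : Fin n → ℂ) : ℕ :=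
  Module.finrank ℝ (LinearMap.range (fderiv ℝ F w).toLinearMap)

/-- Restricting a polynomial to the `j`-th coordinate axis keeps exactly the pure powers of `X j`. -/
theorem coeff_aeval_single_X {σ R : Type*} [DecidableEq σ] [CommRing R]
    (f : MvPolynomial σ R) (j : σ) (k : ℕ) :
    (MvPolynomial.aeval (Pi.single j (Polynomial.X : Polynomial R)) f).coeff k =
      MvPolynomial.coeff (Finsupp.single j k) f := by
  induction f using MvPolynomial.induction_on' with
  | add f g hf hg => simp [hf, hg]
  | monomial d a =>
    rw [MvPolynomial.aeval_monomial, MvPolynomial.coeff_monomial]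
    by_cases hd : d = Finsupp.single j (d j)
    · rw [hd, Finsupp.prod_single_index (by simp)]
      simp [Polynomial.coeff_X_pow, (Finsupp.single_injective j).eq_iff,
        eq_comm]
    · obtain ⟨i, hij, hi⟩ : ∃ i, i ≠ j ∧ d i ≠ 0 := by
        by_contra! h
        apply hd
        ext i
        by_cases hij : i = j
        · subst hij; simp
        · simp [h i hij, Finsupp.single_eq_of_ne hij]
      rw [Finsupp.prod, Finset.prod_eq_zero (Finsupp.mem_support_iff.2 hi) (by simp [hij, hi])]
      rw [if_neg (fun h => hd (by rw [h]; simp))]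
      simp

theorem eval_single_eq_coeff_mul_pow {σ : Type*} [DecidableEq σ] (f : MvPolynomial σ ℂ) (j : σ)
    (N : ℕ) (h : ∀ u : ℂ, u ≠ 0 → MvPolynomial.eval (Pi.single j u) f =
      u ^ N * MvPolynomial.eval (Pi.single j 1) f) (u : ℂ) :
    MvPolynomial.eval (Pi.single j u) f = MvPolynomial.coeff (Finsupp.single j N) f * u ^ N := by
  set P := MvPolynomial.aeval (Pi.single j (Polynomial.X : Polynomial ℂ)) f with hP
  have hPe (u : ℂ) : P.eval u = MvPolynomial.eval (Pi.single j u) f := by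
    rw [hP, ← Polynomial.coe_evalRingHom, MvPolynomial.aeval_def, MvPolynomial.hom_eval₂,
      ← MvPolynomial.eval₂_id]
    congr 1
    · ext; simp
    · ext i
      by_cases hij : i = j
      · subst hij; simp
      · simp [hij]
  have hPX : P = Polynomial.C (MvPolynomial.eval (Pi.single j 1) f) * Polynomial.X ^ N := by
    refine Polynomial.eq_of_infinite_eval_eq _ _ (Set.Infinite.mono (s := {0}ᶜ) ?_
      (Set.finite_singleton (0 : ℂ)).infinite_compl)
    intro u hu
    rw [Set.mem_ofPred_eq, hPe, h u hu]
    rw [Polynomial.eval_mul, Polynomial.eval_C, Polynomial.eval_pow, Polynomial.eval_X, mul_comm]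
  rw [← coeff_aeval_single_X f j N, ← hP, ← hPe u, hPX]
  simp

/-- The real-linear equation satisfied by kernel vectors of the differential of
`u ↦ A u ^ M * conj (B u ^ N) + t * γ * u ^ K` with `M = K + N` has only the zero solution. -/
theorem eq_zero_of_re_pos {A B γ v h : ℂ} {t : ℝ} {N K : ℕ} (hv : v ≠ 0) (ht : 0 < t)
    (hN : 0 < N) (hK : 0 < K) (hre : 0 < ((starRingEnd ℂ) A * B / (starRingEnd ℂ) γ).re)
    (heq : A * v ^ (K + N) * (starRingEnd ℂ) (B * (N * v ^ (N - 1)) * h) +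
      A * ((K + N : ℕ) * v ^ (K + N - 1)) * h * (starRingEnd ℂ) (B * v ^ N) +
      t * γ * (K * v ^ (K - 1)) * h = 0) : h = 0 := by
  have hγ : γ ≠ 0 := by rintro rfl; simp at hre
  by_contra hh
  obtain ⟨r, rfl⟩ : ∃ r, h = r * v := ⟨h / v, by field_simp⟩
  have hr : r ≠ 0 := left_ne_zero_of_mul hh
  obtain ⟨N, rfl⟩ := Nat.exists_eq_succ_of_ne_zero hN.ne'
  obtain ⟨K, rfl⟩ := Nat.exists_eq_succ_of_ne_zero hK.ne'
  set Z := A * (starRingEnd ℂ) B / γ with hZ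
  have hZre : 0 < Z.re := by
    have : Z = (starRingEnd ℂ) ((starRingEnd ℂ) A * B / (starRingEnd ℂ) γ) := by simp [hZ]
    rw [this, conj_re]
    exact hre
  have hA : A * (starRingEnd ℂ) B = Z * γ := by rw [hZ]; field_simp
  set s : ℝ := normSq v ^ (N + 1) with hs
  have hspos : 0 < s := pow_pos (normSq_pos.2 hv) _
  have hsv : (s : ℂ) = v ^ (N + 1) * (starRingEnd ℂ) v ^ (N + 1) := by
    rw [hs, ← mul_pow, mul_conj]; push_cast; rfl
  have key : (((K + 1 + (N + 1) : ℕ) * s : ℝ) * Z + (t * (K + 1 : ℕ) : ℝ)) * r =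
      -(((N + 1 : ℕ) * s : ℝ) * Z * (starRingEnd ℂ) r) := by
    have h0 : v ^ (K + 1) * γ ≠ 0 := mul_ne_zero (pow_ne_zero _ hv) hγ
    apply mul_left_cancel₀ h0
    rw [← sub_eq_zero, ← heq]
    push_cast
    rw [hsv]
    simp only [Nat.succ_eq_add_one, map_mul, map_pow, map_natCast, map_add, map_one,
      show K + 1 + (N + 1) - 1 = K + 1 + N by omega]
    linear_combination (-(v ^ (K + 1) * v ^ (N + 1) * (starRingEnd ℂ) v ^ (N + 1) *
      ((K + 1 + (N + 1)) * r + (N + 1) * (starRingEnd ℂ) r))) * hA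
  have hnorm := congrArg normSq key
  rw [normSq_mul, normSq_neg, normSq_mul, normSq_conj] at hnorm
  have hnorm' := mul_right_cancel₀ (normSq_pos.2 hr).ne' hnorm
  simp only [normSq_apply, add_re, add_im, mul_re, mul_im, ofReal_re, ofReal_im] at hnorm'
  have hNr : (0 : ℝ) < (N + 1 : ℕ) := by positivity
  have hKr : (0 : ℝ) < (K + 1 : ℕ) := by positivity
  push_cast at hnorm' hNr hKr
  have h1 : 0 < s * t * (K + 1) * Z.re * (K + 1 + (N + 1)) := by positivity
  have h2 : 0 < (t * (K + 1)) ^ 2 := by positivity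
  have h3 : 0 ≤ s ^ 2 * (Z.re ^ 2 + Z.im ^ 2) * ((K + 1) ^ 2 + 2 * (K + 1) * (N + 1)) := by
    positivity
  nlinarith

theorem rankAt_ne_one_of_injective {n : ℕ} {F : (Fin n → ℂ) → ℂ} {w : Fin n → ℂ} (j : Fin n)
    (h : ∀ u : ℂ, fderiv ℝ F w (Pi.single j u) = 0 → u = 0) : rankAt F w ≠ 1 := by
  intro h1
  set L := (fderiv ℝ F w).toLinearMap with hL
  set G := L ∘ₗ LinearMap.single ℝ (fun _ : Fin n => ℂ) j
  have hG : Function.Injective G := (injective_iff_map_eq_zero G).2 fun u hu => h u hu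
  have h2 := LinearMap.finrank_range_of_inj hG
  have h3 := Submodule.finrank_mono (LinearMap.range_comp_le_range
    (LinearMap.single ℝ (fun _ : Fin n => ℂ) j) L)
  have h4 : Module.finrank ℝ (LinearMap.range L) = 1 := h1
  rw [h4, LinearMap.finrank_range_of_inj hG, Complex.finrank_real_complex] at h3
  omega

theorem rankAt_ne_one_of_complex_linear {n : ℕ} {F : (Fin n → ℂ) → ℂ} {w : Fin n → ℂ}
    (L : (Fin n → ℂ) →L[ℂ] ℂ) (h : fderiv ℝ F w = L.restrictScalars ℝ) : rankAt F w ≠ 1 := by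
  rw [rankAt, h]
  by_cases hL : L = 0
  · subst hL
    have : LinearMap.range ((0 : (Fin n → ℂ) →L[ℂ] ℂ).restrictScalars ℝ).toLinearMap = ⊥ := by
      rw [LinearMap.range_eq_bot]; rfl
    rw [this]; simp
  · have hL' : L.toLinearMap ≠ 0 := fun h0 => hL (ContinuousLinearMap.coe_injective h0)
    have : LinearMap.range (L.restrictScalars ℝ).toLinearMap = ⊤ :=
      LinearMap.range_eq_top.2 (LinearMap.surjective hL')
    rw [this, finrank_top, Complex.finrank_real_complex]
    norm_num

theorem MvPolynomial.differentiable_eval {σ : Type*} [Fintype σ] (f : MvPolynomial σ ℂ) :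
    Differentiable ℂ fun z : σ → ℂ => MvPolynomial.eval z f := by
  induction f using MvPolynomial.induction_on with
  | C a => simp
  | add f g hf hg => simpa using! hf.add hg
  | mul_X f i hf => simpa using! hf.mul (differentiable_apply i)

theorem rankAt_mul_conj_add_ne_one_of_eq_zero {n : ℕ} {φ ψ η : (Fin n → ℂ) → ℂ} {w : Fin n → ℂ}
    (hφ : DifferentiableAt ℂ φ w) (hψ : DifferentiableAt ℂ ψ w) (hη : DifferentiableAt ℂ η w)
    (hφ0 : φ w = 0) (hψ0 : ψ w = 0) :
    rankAt (fun z => φ z * (starRingEnd ℂ) (ψ z) + η z) w ≠ 1 := by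
  apply rankAt_ne_one_of_complex_linear (fderiv ℂ η w)
  have h1 := hφ.hasFDerivAt.restrictScalars ℝ
  have h2 := conjCLE.hasFDerivAt.comp w (hψ.hasFDerivAt.restrictScalars ℝ)
  have h3 := (h1.mul h2).add (hη.hasFDerivAt.restrictScalars ℝ)
  refine Eq.trans (HasFDerivAt.fderiv h3) ?_
  ext u
  simp [hφ0, hψ0]

theorem rankAt_ne_one_of_axis_form {n : ℕ} {F : (Fin n → ℂ) → ℂ} (j : Fin n) {A B γ v : ℂ} {t : ℝ}
    {M N K : ℕ} (hM : M = K + N) (hv : v ≠ 0) (ht : 0 < t) (hN : 0 < N) (hK : 0 < K)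
    (hre : 0 < ((starRingEnd ℂ) A * B / (starRingEnd ℂ) γ).re)
    (hF : DifferentiableAt ℝ F (Pi.single j v))
    (hform : ∀ u : ℂ, F (Pi.single j u) =
      A * u ^ M * (starRingEnd ℂ) (B * u ^ N) + t * γ * u ^ K) :
    rankAt F (Pi.single j v) ≠ 1 := by
  subst hM
  apply rankAt_ne_one_of_injective j
  intro h hh
  have h1 := ((hasDerivAt_pow (K + N) v).const_mul A).hasFDerivAt.restrictScalars ℝ
  have h2 := conjCLE.hasFDerivAt.comp v
    (((hasDerivAt_pow N v).const_mul B).hasFDerivAt.restrictScalars ℝ)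
  have h3 := ((hasDerivAt_pow K v).const_mul (t * γ)).hasFDerivAt.restrictScalars ℝ
  have h4 := (h1.mul h2).add h3
  have h5 := hF.hasFDerivAt.comp v
    (ContinuousLinearMap.single ℝ (fun _ : Fin n => ℂ) j).hasFDerivAt
  have h6 := h5.unique (h4.congr_of_eventuallyEq (.of_forall fun u => hform u))
  have h7 := DFunLike.congr_fun h6 h
  refine eq_zero_of_re_pos hv ht hN hK hre (h := h) ?_
  refine Eq.trans ?_ (h7.symm.trans hh)
  simp
  ring

/-- If `Re(conj(a_j)·b_j / conj(γ_j)) > 0` for `j = 1,2`, then every rank-one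
singularity of `F_t = fḡ + t·h` has both coordinates nonzero. -/
theorem stmt_12
    (p q m n : ℕ) (hp : 0 < p) (hq : 0 < q) (hm : 0 < m) (hn : 0 < n)
    (hmn : n < m) (hpq : p ≤ q)
    (f g : MvPolynomial (Fin 2) ℂ)
    (hf : ∀ c : ℂ, c ≠ 0 → ∀ z : Fin 2 → ℂ,
      MvPolynomial.eval ![c ^ q * z 0, c ^ p * z 1] f =
        c ^ (p * q * m) * MvPolynomial.eval z f)
    (hg : ∀ c : ℂ, c ≠ 0 → ∀ z : Fin 2 → ℂ,
      MvPolynomial.eval ![c ^ q * z 0, c ^ p * z 1] g =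
        c ^ (p * q * n) * MvPolynomial.eval z g)
    (a₁ a₂ b₁ b₂ : ℂ)
    (ha₁def : a₁ = MvPolynomial.coeff (Finsupp.single 0 (p * m)) f) (ha₁ : a₁ ≠ 0)
    (ha₂def : a₂ = MvPolynomial.coeff (Finsupp.single 1 (q * m)) f) (ha₂ : a₂ ≠ 0)
    (hb₁def : b₁ = MvPolynomial.coeff (Finsupp.single 0 (p * n)) g) (hb₁ : b₁ ≠ 0)
    (hb₂def : b₂ = MvPolynomial.coeff (Finsupp.single 1 (q * n)) g) (hb₂ : b₂ ≠ 0)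
    (hsing0 : IsSingularity
      (fun z => MvPolynomial.eval z f * (starRingEnd ℂ) (MvPolynomial.eval z g)) 0)
    (hiso : ∃ ε : ℝ, 0 < ε ∧ ∀ w : Fin 2 → ℂ, w ≠ 0 → ‖w‖ < ε → ¬ IsSingularity
      (fun z => MvPolynomial.eval z f * (starRingEnd ℂ) (MvPolynomial.eval z g)) w)
    (γ₁ γ₂ : ℂ) (hγ₁ : γ₁ ≠ 0) (hγ₂ : γ₂ ≠ 0)
    (hre₁ : 0 < ((starRingEnd ℂ) a₁ * b₁ / (starRingEnd ℂ) γ₁).re)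
    (hre₂ : 0 < ((starRingEnd ℂ) a₂ * b₂ / (starRingEnd ℂ) γ₂).re)
    (t : ℝ) (ht : 0 < t)
    (F : (Fin 2 → ℂ) → ℂ)
    (hF : F = fun z =>
      MvPolynomial.eval z f * (starRingEnd ℂ) (MvPolynomial.eval z g) +
        (t : ℂ) * (γ₁ * z 0 ^ (p * (m - n)) + γ₂ * z 1 ^ (q * (m - n)))) :
    ∀ w : Fin 2 → ℂ, rankAt F w = 1 → w 0 ≠ 0 ∧ w 1 ≠ 0 := by
  have hfd := (MvPolynomial.differentiable_eval f)
  have hgd := (MvPolynomial.differentiable_eval g)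
  have hηd : Differentiable ℂ fun z : Fin 2 → ℂ =>
      (t : ℂ) * (γ₁ * z 0 ^ (p * (m - n)) + γ₂ * z 1 ^ (q * (m - n))) := by fun_prop
  have hFd : Differentiable ℝ F := by
    rw [hF]
    exact ((hfd.restrictScalars ℝ).mul (conjCLE.differentiable.comp (hgd.restrictScalars ℝ))).add
      (hηd.restrictScalars ℝ)
  have hsingle0 (u : ℂ) : (Pi.single 0 u : Fin 2 → ℂ) = ![u, 0] := by
    ext i; fin_cases i <;> simp
  have hsingle1 (u : ℂ) : (Pi.single 1 u : Fin 2 → ℂ) = ![0, u] := by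
    ext i; fin_cases i <;> simp
  have haxis (k : ℕ) (P : MvPolynomial (Fin 2) ℂ)
      (hP : ∀ c : ℂ, c ≠ 0 → ∀ z : Fin 2 → ℂ,
        MvPolynomial.eval ![c ^ q * z 0, c ^ p * z 1] P =
          c ^ (p * q * k) * MvPolynomial.eval z P) :
      (∀ u : ℂ, MvPolynomial.eval (Pi.single 0 u) P =
        MvPolynomial.coeff (Finsupp.single 0 (p * k)) P * u ^ (p * k)) ∧
      ∀ u : ℂ, MvPolynomial.eval (Pi.single 1 u) P =
        MvPolynomial.coeff (Finsupp.single 1 (q * k)) P * u ^ (q * k) := by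
    constructor
    · refine eval_single_eq_coeff_mul_pow P 0 (p * k) fun u hu => ?_
      obtain ⟨c, rfl⟩ := IsAlgClosed.exists_pow_nat_eq u hq
      have hc : c ≠ 0 := by rintro rfl; simp [hq.ne'] at hu
      have := hP c hc (Pi.single 0 1)
      rw [← pow_mul, ← mul_assoc, mul_comm q p, ← this, hsingle0]
      simp
    · refine eval_single_eq_coeff_mul_pow P 1 (q * k) fun u hu => ?_
      obtain ⟨c, rfl⟩ := IsAlgClosed.exists_pow_nat_eq u hp
      have hc : c ≠ 0 := by rintro rfl; simp [hp.ne'] at hu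
      have := hP c hc (Pi.single 1 1)
      rw [← pow_mul, ← mul_assoc, ← this, hsingle1]
      simp
  obtain ⟨hf0, hf1⟩ := haxis m f hf
  obtain ⟨hg0, hg1⟩ := haxis n g hg
  rw [← ha₁def] at hf0
  rw [← ha₂def] at hf1
  rw [← hb₁def] at hg0
  rw [← hb₂def] at hg1
  have hmn0 : 0 < m - n := Nat.sub_pos_of_lt hmn
  have hdeg (r : ℕ) : r * m = r * (m - n) + r * n := by rw [← mul_add, Nat.sub_add_cancel hmn.le]
  have hr0 : rankAt F 0 ≠ 1 := by
    rw [hF]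
    refine rankAt_mul_conj_add_ne_one_of_eq_zero (hfd 0) (hgd 0) (hηd 0) ?_ ?_
    · simpa [hp.ne', hm.ne'] using hf0 0
    · simpa [hp.ne', hn.ne'] using hg0 0
  have hr1 (v : ℂ) : rankAt F (Pi.single 0 v) ≠ 1 := by
    by_cases hv : v = 0
    · simpa [hv] using hr0
    refine rankAt_ne_one_of_axis_form 0 (hdeg p) hv ht (Nat.mul_pos hp hn) (Nat.mul_pos hp hmn0)
      hre₁ (hFd _) fun u => ?_
    simp [hF, hf0, hg0, hq.ne', hmn0.ne', mul_assoc]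
  have hr2 (v : ℂ) : rankAt F (Pi.single 1 v) ≠ 1 := by
    by_cases hv : v = 0
    · simpa [hv] using hr0
    refine rankAt_ne_one_of_axis_form 1 (hdeg q) hv ht (Nat.mul_pos hq hn) (Nat.mul_pos hq hmn0)
      hre₂ (hFd _) fun u => ?_
    simp [hF, hf1, hg1, hp.ne', hmn0.ne', mul_assoc]
  intro w hw
  refine ⟨fun h0 => hr2 (w 1) ?_, fun h1 => hr1 (w 0) ?_⟩
  · rwa [hsingle1, ← h0, ← List.ofFn_inj.1 (by simp : List.ofFn w = List.ofFn ![w 0, w 1])]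
  · rwa [hsingle0, ← h1, ← List.ofFn_inj.1 (by simp : List.ofFn w = List.ofFn ![w 0, w 1])]

end
end

section
/- In the setting of the weighted homogeneous pair (f,g), assume in addition that g is not a linear polynomial. Then there exist γ_1, γ_2 ∈ ℂ∖{0} with Re(conj(a_j)·b_j / conj(γ_j)) > 0 for j = 1,2, and t_0 > 0, such that for every t with 0 < t < t_0 the mixed polynomial F_t = fḡ + t·(γ_1 z_1^{p(m−n)} + γ_2 z_2^{q(m−n)}) satisfies: det H(F_t)(w) ≠ 0 and F_t(w) ≠ 0 for every w ∈ S_1(F_t). -/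
open Complex

noncomputable section

/-- The mixed Hessian `H(P)` of a mixed polynomial, a `2n × 2n` matrix (indexed by
`Fin n ⊕ Fin n`) with block form
`[[∂²P/∂z_j∂z_k, ∂²P/∂z_j∂z̄_k], [∂²P/∂z̄_j∂z_k, ∂²P/∂z̄_j∂z̄_k]]`. -/
def mixedHessian {n : ℕ} (P : (Fin n → ℂ) → ℂ) (w : Fin n → ℂ) :
    Matrix (Fin n ⊕ Fin n) (Fin n ⊕ Fin n) ℂ :=
  Matrix.of fun a b =>
    match a, b with
    | Sum.inl j, Sum.inl k => wD (fun z => wD P k z) j w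
    | Sum.inl j, Sum.inr k => wD (fun z => wDbar P k z) j w
    | Sum.inr j, Sum.inl k => wDbar (fun z => wD P k z) j w
    | Sum.inr j, Sum.inr k => wDbar (fun z => wDbar P k z) j w

/-- The real coordinate directions of `ℂⁿ ≅ ℝ^{2n}`: `inl j ↦ x_j`-direction,
`inr j ↦ y_j`-direction. -/
def dirC {n : ℕ} : (Fin n ⊕ Fin n) → (Fin n → ℂ)
  | Sum.inl j => Pi.single j 1
  | Sum.inr j => Pi.single j Complex.I

/-- The real Hessian `H_ℝ(η)` of `η : ℂⁿ ≅ ℝ^{2n} → ℝ` in the coordinates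
`(x_1,…,x_n,y_1,…,y_n)`. -/
def realHessian {n : ℕ} (η : (Fin n → ℂ) → ℝ) (w : Fin n → ℂ) :
    Matrix (Fin n ⊕ Fin n) (Fin n ⊕ Fin n) ℝ :=
  Matrix.of fun a b => fderiv ℝ (fun z => fderiv ℝ η z (dirC b)) w (dirC a)

open MeasureTheory in
theorem addHaar_eq_zero_of_countable_rays {E : Type*} [NormedAddCommGroup E] [NormedSpace ℝ E]
    [MeasurableSpace E] [BorelSpace E] [FiniteDimensional ℝ E] [Nontrivial E]
    (μ : Measure E) [μ.IsAddHaarMeasure] {s : Set E} (hs : IsClosed s)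
    (h : ∀ x : E, {t : ℝ | t • x ∈ s}.Countable) : μ s = 0 := by
  have hmp := μ.measurePreserving_homeomorphUnitSphereProd
  set e := homeomorphUnitSphereProd E
  have hT : MeasurableSet (e.symm ⁻¹' ((↑) ⁻¹' s : Set ({0}ᶜ : Set E))) :=
    ((hs.preimage continuous_subtype_val).preimage e.symm.continuous).measurableSet
  have h0 : (μ.toSphere.prod (Measure.volumeIoiPow (Module.finrank ℝ E - 1)))
      (e.symm ⁻¹' ((↑) ⁻¹' s : Set ({0}ᶜ : Set E))) = 0 := by
    rw [Measure.measure_prod_null hT]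
    refine Filter.Eventually.of_forall fun x => ?_
    have hc : (Prod.mk x ⁻¹' (e.symm ⁻¹' ((↑) ⁻¹' s : Set ({0}ᶜ : Set E)))).Countable := by
      refine Set.Countable.mono ?_ ((h x.1).preimage Subtype.val_injective)
      intro r hr
      simpa [e, homeomorphUnitSphereProd] using hr
    refine (withDensity_absolutelyContinuous _ _) ?_
    rw [comap_subtype_coe_apply measurableSet_Ioi]
    exact (hc.image _).measure_zero _
  have h1 := hmp.measure_preimage hT.nullMeasurableSet
  rw [h0, ← Set.preimage_comp] at h1
  have : (e.symm ∘ e) = id := by ext x; simp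
  rw [this, Set.preimage_id, comap_subtype_coe_apply (measurableSet_singleton _).compl,
    Subtype.image_preimage_coe] at h1
  have h2 : s ⊆ ({0}ᶜ ∩ s) ∪ {0} := by
    intro x hx
    by_cases hx0 : x = 0 <;> simp [hx, hx0]
  refine measure_mono_null h2 (measure_union_null h1 (measure_singleton _))

/-- The point `(z, conj z)` at which the polynomial of a mixed polynomial is evaluated. -/
def withConj {n : ℕ} (z : Fin n → ℂ) : Fin n ⊕ Fin n → ℂ :=
  Sum.elim z fun j => (starRingEnd ℂ) (z j)

theorem exists_eval_withConj_ne_zero {n : ℕ} {K : MvPolynomial (Fin n ⊕ Fin n) ℂ} (hK : K ≠ 0) :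
    ∃ z, MvPolynomial.eval (withConj z) K ≠ 0 := by
  by_contra! hcon
  apply hK
  set S : Fin n ⊕ Fin n → MvPolynomial (Fin n ⊕ Fin n) ℂ :=
    Sum.elim (fun j => .X (.inl j) + .C I * .X (.inr j))
      (fun j => .X (.inl j) - .C I * .X (.inr j)) with hS
  have h0 : MvPolynomial.bind₁ S K = 0 := by
    refine MvPolynomial.funext_set (fun _ => Set.range ((↑) : ℝ → ℂ))
      (fun _ => Set.infinite_range_of_injective Complex.ofReal_injective) fun x hx => ?_
    choose y hy using fun i => hx i (Set.mem_univ i)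
    have : MvPolynomial.eval x (MvPolynomial.bind₁ S K)
        = MvPolynomial.eval (fun i => MvPolynomial.eval x (S i)) K := by
      simpa [MvPolynomial.coe_aeval_eq_eval] using
        MvPolynomial.aeval_bind₁ (R := ℂ) x S K
    rw [this, map_zero]
    convert hcon (fun j => y (.inl j) + I * y (.inr j)) using 3
    funext i
    rcases i with j | j <;> simp [hS, withConj, ← hy, sub_eq_add_neg]
  refine MvPolynomial.funext fun x => ?_
  have h1 := congrArg (MvPolynomial.eval (Sum.elim
    (fun j => (x (.inl j) + x (.inr j)) / 2) (fun j => (x (.inl j) - x (.inr j)) / (2 * I)))) h0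
  have : ∀ x, MvPolynomial.eval x (MvPolynomial.bind₁ S K)
        = MvPolynomial.eval (fun i => MvPolynomial.eval x (S i)) K := fun x => by
      simpa [MvPolynomial.coe_aeval_eq_eval] using
        MvPolynomial.aeval_bind₁ (R := ℂ) x S K
  rw [this, map_zero] at h1
  rw [map_zero, ← h1]
  congr 2
  funext i
  rcases i with j | j <;> simp [hS] <;> field_simp <;> ring

theorem continuous_withConj {n : ℕ} : Continuous (withConj (n := n)) := by
  refine continuous_pi fun i => ?_
  rcases i with j | j
  · exact continuous_apply j
  · exact Complex.continuous_conj.comp (continuous_apply j)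

open MeasureTheory in
theorem volume_eval_withConj_eq_zero {n : ℕ} [NeZero n] {K : MvPolynomial (Fin n ⊕ Fin n) ℂ}
    (hK : K ≠ 0) : volume {z : Fin n → ℂ | MvPolynomial.eval (withConj z) K = 0} = 0 := by
  obtain ⟨z₀, hz₀⟩ := exists_eval_withConj_ne_zero hK
  set s := {z : Fin n → ℂ | MvPolynomial.eval (withConj z) K = 0} with hs
  have hsc : IsClosed s :=
    isClosed_eq ((MvPolynomial.continuous_eval K).comp continuous_withConj) continuous_const
  rw [← measure_preimage_add volume z₀ s]
  refine addHaar_eq_zero_of_countable_rays volume (hsc.preimage (by fun_prop)) fun x => ?_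
  set R : Polynomial ℂ := MvPolynomial.aeval
    (fun i => Polynomial.C (withConj z₀ i) + Polynomial.C (withConj x i) * Polynomial.X) K
  have hR : ∀ t : ℝ, R.eval (t : ℂ) = MvPolynomial.eval (withConj (z₀ + t • x)) K := by
    intro t
    rw [← Polynomial.coe_evalRingHom, MvPolynomial.map_aeval, MvPolynomial.coe_eval₂Hom,
      ← MvPolynomial.eval₂_id]
    congr 1
    · ext
      simp
    · funext i
      rcases i with j | j <;> simp [withConj] <;> ring
  have hR0 : R ≠ 0 := by
    intro h
    apply hz₀
    have := hR 0
    simpa [h] using this.symm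
  refine Set.Countable.mono ?_ (((R.roots.toFinset.countable_toSet)).preimage
    Complex.ofReal_injective)
  intro t ht
  simp only [Set.mem_ofPred_eq, Set.mem_preimage, hs] at ht
  simp [hR0, Polynomial.IsRoot, hR, ht]

section MixedDerivatives

open MvPolynomial

variable {n : ℕ}

theorem hasFDerivAt_eval_withConj (K : MvPolynomial (Fin n ⊕ Fin n) ℂ) (w : Fin n → ℂ) :
    HasFDerivAt (fun z => eval (withConj z) K)
      (∑ j, (eval (withConj w) (pderiv (.inl j) K) •
          (ContinuousLinearMap.proj j : (Fin n → ℂ) →L[ℝ] ℂ) +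
        eval (withConj w) (pderiv (.inr j) K) •
          (Complex.conjCLE : ℂ →L[ℝ] ℂ).comp
            (ContinuousLinearMap.proj j : (Fin n → ℂ) →L[ℝ] ℂ))) w := by
  induction K using MvPolynomial.induction_on with
  | C a =>
    simp only [eval_C]
    refine (hasFDerivAt_const a w).congr_fderiv ?_
    ext v
    simp
  | add p q hp hq =>
    have h : HasFDerivAt (fun z => eval (withConj z) (p + q)) _ w :=
      (hp.add hq).congr_of_eventuallyEq (.of_forall fun z => by simp)
    refine h.congr_fderiv ?_
    ext v
    simp only [sum_apply, add_apply, ← Finset.sum_add_distrib]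
    refine Finset.sum_congr rfl fun j _ => ?_
    simp
    ring
  | mul_X p i hp =>
    have hX : HasFDerivAt (fun z : Fin n → ℂ => withConj z i)
        (∑ j, (eval (withConj w) (pderiv (.inl j) (X i : MvPolynomial (Fin n ⊕ Fin n) ℂ)) •
            (ContinuousLinearMap.proj j : (Fin n → ℂ) →L[ℝ] ℂ) +
          eval (withConj w) (pderiv (.inr j) (X i : MvPolynomial (Fin n ⊕ Fin n) ℂ)) •
            (Complex.conjCLE : ℂ →L[ℝ] ℂ).comp
              (ContinuousLinearMap.proj j : (Fin n → ℂ) →L[ℝ] ℂ))) w := by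
      rcases i with i | i
      · refine (ContinuousLinearMap.proj (R := ℝ) (φ := fun _ : Fin n => ℂ)
          i).hasFDerivAt.congr_fderiv ?_
        ext v
        simp only [sum_apply, add_apply, smul_apply, pderiv_X, Pi.single_apply, Sum.inl.injEq,
          reduceCtorEq, if_false, map_zero, zero_smul, add_zero]
        rw [Finset.sum_eq_single i] <;> simp +contextual [eq_comm]
      · refine ((Complex.conjCLE : ℂ →L[ℝ] ℂ).comp
          (ContinuousLinearMap.proj (R := ℝ) (φ := fun _ : Fin n => ℂ)
            i)).hasFDerivAt.congr_fderiv ?_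
        ext v
        simp only [sum_apply, add_apply, smul_apply, pderiv_X, Pi.single_apply,
          Sum.inr.injEq, reduceCtorEq, if_false, map_zero, zero_smul, zero_add]
        rw [Finset.sum_eq_single i] <;> simp +contextual [eq_comm]
    have h : HasFDerivAt (fun z => eval (withConj z) (p * X i)) _ w :=
      (hp.mul hX).congr_of_eventuallyEq (.of_forall fun z => by simp)
    refine h.congr_fderiv ?_
    ext v
    simp only [sum_apply, add_apply, smul_apply,
      Finset.smul_sum, ← Finset.sum_add_distrib]
    refine Finset.sum_congr rfl fun j _ => ?_
    simp
    ring

theorem fderiv_eval_withConj_apply (K : MvPolynomial (Fin n ⊕ Fin n) ℂ) (w v : Fin n → ℂ) :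
    fderiv ℝ (fun z => eval (withConj z) K) w v =
      ∑ j, (eval (withConj w) (pderiv (.inl j) K) * v j +
        eval (withConj w) (pderiv (.inr j) K) * (starRingEnd ℂ) (v j)) := by
  rw [(hasFDerivAt_eval_withConj K w).fderiv]
  simp

theorem fderiv_eval_withConj_single (K : MvPolynomial (Fin n ⊕ Fin n) ℂ) (w : Fin n → ℂ)
    (j : Fin n) (x : ℂ) :
    fderiv ℝ (fun z => eval (withConj z) K) w (Pi.single j x) =
      eval (withConj w) (pderiv (.inl j) K) * x +
        eval (withConj w) (pderiv (.inr j) K) * (starRingEnd ℂ) x := by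
  rw [fderiv_eval_withConj_apply, Finset.sum_eq_single j]
  · simp
  · intro i _ hij
    simp [hij]
  · simp

theorem wD_eval_withConj (K : MvPolynomial (Fin n ⊕ Fin n) ℂ) (j : Fin n) :
    wD (fun z => eval (withConj z) K) j =
      fun z => eval (withConj z) (pderiv (.inl j) K) := by
  funext w
  simp only [wD, fderiv_eval_withConj_single]
  simp only [map_one, conj_I]
  linear_combination (-(1 / 2 : ℂ) * eval (withConj w) (pderiv (.inl j) K) +
    1 / 2 * eval (withConj w) (pderiv (.inr j) K)) * Complex.I_sq

theorem wDbar_eval_withConj (K : MvPolynomial (Fin n ⊕ Fin n) ℂ) (j : Fin n) :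
    wDbar (fun z => eval (withConj z) K) j =
      fun z => eval (withConj z) (pderiv (.inr j) K) := by
  funext w
  simp only [wDbar, fderiv_eval_withConj_single]
  simp only [map_one, conj_I]
  linear_combination ((1 / 2 : ℂ) * eval (withConj w) (pderiv (.inl j) K) -
    1 / 2 * eval (withConj w) (pderiv (.inr j) K)) * Complex.I_sq

theorem mixedHessian_eval_withConj (K : MvPolynomial (Fin n ⊕ Fin n) ℂ) (w : Fin n → ℂ) :
    mixedHessian (fun z => eval (withConj z) K) w =
      Matrix.of fun a b => eval (withConj w) (pderiv a (pderiv b K)) := by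
  ext a b
  rcases a with j | j <;> rcases b with k | k <;>
    simp [mixedHessian, wD_eval_withConj, wDbar_eval_withConj]

theorem exists_unit_of_rankAt_eq_one (K : MvPolynomial (Fin n ⊕ Fin n) ℂ) (w : Fin n → ℂ)
    (h : rankAt (fun z => eval (withConj z) K) w = 1) :
    ∃ β : ℂ, ‖β‖ = 1 ∧ ∀ j, β * (starRingEnd ℂ) (eval (withConj w) (pderiv (.inr j) K)) =
      eval (withConj w) (pderiv (.inl j) K) := by
  obtain ⟨⟨e, he⟩, he0, hspan⟩ := finrank_eq_one_iff'.1 h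
  have he0' : e ≠ 0 := fun h0 => he0 (Subtype.ext h0)
  have hec : (starRingEnd ℂ) e ≠ 0 := by simpa using he0'
  refine ⟨e / (starRingEnd ℂ) e, ?_, fun j => ?_⟩
  · rw [norm_div, RCLike.norm_conj, div_self (norm_ne_zero_iff.2 he0')]
  have key : ∀ x : ℂ, ∃ r : ℝ, r * e = eval (withConj w) (pderiv (.inl j) K) * x +
        eval (withConj w) (pderiv (.inr j) K) * (starRingEnd ℂ) x := by
    intro x
    obtain ⟨r, hr⟩ := hspan ⟨_, Pi.single j x, rfl⟩
    refine ⟨r, ?_⟩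
    rw [← fderiv_eval_withConj_single]
    simpa using congrArg Subtype.val hr
  obtain ⟨r, hr⟩ := key 1
  obtain ⟨s, hs⟩ := key I
  rw [map_one] at hr
  rw [conj_I] at hs
  set A := eval (withConj w) (pderiv (.inl j) K)
  set B := eval (withConj w) (pderiv (.inr j) K)
  have hA : A = (r - I * s) / 2 * e := by
    linear_combination -(1 / 2 : ℂ) * hr + 1 / 2 * I * hs + ((1 / 2 : ℂ) * A - 1 / 2 * B) * I_sq
  have hB : B = (r + I * s) / 2 * e := by
    linear_combination -(1 / 2 : ℂ) * hr - 1 / 2 * I * hs + (-(1 / 2 : ℂ) * A + 1 / 2 * B) * I_sq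
  rw [hA, hB]
  simp [map_ofNat]
  field_simp
  ring

theorem rankAt_eq_zero (K : MvPolynomial (Fin n ⊕ Fin n) ℂ) (w : Fin n → ℂ)
    (h : ∀ a, eval (withConj w) (pderiv a K) = 0) :
    rankAt (fun z => eval (withConj z) K) w = 0 := by
  have h0 : fderiv ℝ (fun z => eval (withConj z) K) w = 0 := by
    ext v
    rw [fderiv_eval_withConj_apply]
    simp [h]
  simp [rankAt, h0]

theorem isSingularity_of_pderiv_eq_zero (K : MvPolynomial (Fin n ⊕ Fin n) ℂ) (w : Fin n → ℂ)
    (h : ∀ a, eval (withConj w) (pderiv a K) = 0) :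
    IsSingularity (fun z => eval (withConj z) K) w := by
  have h0 : HasFDerivAt (fun z => eval (withConj z) K) (0 : (Fin n → ℂ) →L[ℝ] ℂ) w :=
    (hasFDerivAt_eval_withConj K w).congr_fderiv (by
      ext v; simp [h])
  have h1 : fderiv ℝ (fun z => (eval (withConj z) K).re) w = 0 := by
    have h2 := (Complex.reCLM.hasFDerivAt.comp w h0).fderiv
    rw [ContinuousLinearMap.comp_zero] at h2
    exact h2
  exact ⟨1, 0, by simp, by simp [h1]⟩

end MixedDerivatives

section QuasiHomogeneous

open MvPolynomial

/-- The logarithmic derivative `z_j ∂/∂z_j`. -/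
def theta {σ : Type*} (j : σ) : Derivation ℂ (MvPolynomial σ ℂ) (MvPolynomial σ ℂ) :=
  (X j : MvPolynomial σ ℂ) • pderiv j

theorem theta_apply {σ : Type*} (j : σ) (φ : MvPolynomial σ ℂ) :
    theta j φ = X j * pderiv j φ := rfl

theorem coeff_theta {σ : Type*} (j : σ) (φ : MvPolynomial σ ℂ) (s : σ →₀ ℕ) :
    coeff s (theta j φ) = s j * coeff s φ := by
  classical
  induction φ using MvPolynomial.induction_on' with
  | monomial u a =>
    rw [theta_apply, X_mul_pderiv_monomial, coeff_smul, coeff_monomial]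
    split_ifs with h
    · simp [h]
    · simp
  | add p q hp hq => rw [map_add, coeff_add, coeff_add, hp, hq, mul_add]

theorem theta_comm {σ : Type*} (i j : σ) (φ : MvPolynomial σ ℂ) :
    theta i (theta j φ) = theta j (theta i φ) := by
  ext s
  simp only [coeff_theta]
  ring

theorem X_mul_X_mul_pderiv_pderiv {σ : Type*} [DecidableEq σ] (a b : σ)
    (φ : MvPolynomial σ ℂ) :
    X a * X b * pderiv a (pderiv b φ) = theta a (theta b φ) - if a = b then theta b φ else 0 := by
  simp only [theta_apply, Derivation.leibniz, pderiv_X, smul_eq_mul, Pi.single_apply]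
  split_ifs with h1 h2 h2
  · subst h1
    ring
  · exact absurd h1.symm h2
  · exact absurd h2.symm h1
  · ring

/-- `φ` is quasi-homogeneous of degree `D` for the weights `q, p`. -/
def IsQuasiHom (q p D : ℕ) (φ : MvPolynomial (Fin 2) ℂ) : Prop :=
  ∀ s, coeff s φ ≠ 0 → q * s 0 + p * s 1 = D

variable {q p D : ℕ} {φ : MvPolynomial (Fin 2) ℂ}

theorem isQuasiHom_of_eval
    (h : ∀ c : ℂ, c ≠ 0 → ∀ z : Fin 2 → ℂ,
      eval ![c ^ q * z 0, c ^ p * z 1] φ = c ^ D * eval z φ) : IsQuasiHom q p D φ := by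
  have hcoeff : ∀ (ψ : MvPolynomial (Fin 2) ℂ) (s : Fin 2 →₀ ℕ),
      coeff s (aeval ![C (2 ^ q) * X 0, C (2 ^ p) * X 1] ψ : MvPolynomial (Fin 2) ℂ) =
        2 ^ (q * s 0 + p * s 1) * coeff s ψ := by
    intro ψ s
    induction ψ using MvPolynomial.induction_on' with
    | monomial u a =>
      have : (aeval ![C (2 ^ q) * X 0, C (2 ^ p) * X 1] (monomial u a) :
          MvPolynomial (Fin 2) ℂ) = C (2 ^ (q * u 0 + p * u 1)) * monomial u a := by
        rw [aeval_monomial, monomial_eq, Finsupp.prod_fintype _ _ (by simp),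
          Finsupp.prod_fintype _ _ (by simp)]
        simp only [Fin.prod_univ_two, algebraMap_eq, Matrix.cons_val_zero, Matrix.cons_val_one,
          mul_pow, ← C_pow, ← pow_mul, pow_add, C_mul]
        ring
      rw [this, coeff_C_mul, coeff_monomial]
      split_ifs with h
      · rw [h]
      · simp
    | add a b ha hb => rw [map_add, coeff_add, coeff_add, ha, hb, mul_add]
  have heq : (aeval ![C (2 ^ q) * X 0, C (2 ^ p) * X 1] φ : MvPolynomial (Fin 2) ℂ) =
      C (2 ^ D) * φ := by
    refine MvPolynomial.funext fun z => ?_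
    rw [map_mul, eval_C, ← h 2 two_ne_zero z, map_aeval, coe_eval₂Hom,
      ← eval₂_id φ]
    congr 1
    · ext; simp
    · funext i
      fin_cases i <;> simp
  intro s hs
  have h2 := congrArg (coeff s) heq
  rw [hcoeff, coeff_C_mul] at h2
  have h3 := mul_right_cancel₀ hs h2
  exact_mod_cast Nat.pow_right_injective le_rfl (by exact_mod_cast h3)

theorem IsQuasiHom.logDeriv (h : IsQuasiHom q p D φ) (j : Fin 2) :
    IsQuasiHom q p D (theta j φ) := by
  intro s hs
  rw [coeff_theta] at hs
  exact h s (right_ne_zero_of_mul hs)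

theorem IsQuasiHom.euler (h : IsQuasiHom q p D φ) :
    (q : MvPolynomial (Fin 2) ℂ) * theta 0 φ + p * theta 1 φ = D * φ := by
  ext s
  simp only [← C_eq_coe_nat, coeff_add, coeff_C_mul, coeff_theta]
  by_cases hs : coeff s φ = 0
  · simp [hs]
  · rw [← h s hs]
    push_cast
    ring

theorem IsQuasiHom.euler_eval (h : IsQuasiHom q p D φ) (z : Fin 2 → ℂ) :
    q * eval z (theta 0 φ) + p * eval z (theta 1 φ) = D * eval z φ := by
  simpa using congrArg (eval z) h.euler

theorem IsQuasiHom.eval_smul (h : IsQuasiHom q p D φ) (c : ℂ) (z : Fin 2 → ℂ) :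
    eval ![c ^ q * z 0, c ^ p * z 1] φ = c ^ D * eval z φ := by
  rw [eval_eq', eval_eq', Finset.mul_sum]
  refine Finset.sum_congr rfl fun s hs => ?_
  rw [← h s (mem_support_iff.1 hs)]
  simp only [Fin.prod_univ_two, Matrix.cons_val_zero, Matrix.cons_val_one, mul_pow, pow_add,
    pow_mul]
  ring

theorem IsQuasiHom.eval_zero_left {K : ℕ} (hp : 0 < p) (h : IsQuasiHom q p (p * K) φ) (y : ℂ) :
    eval ![0, y] φ = coeff (Finsupp.single 1 K) φ * y ^ K := by
  rw [eval_eq', Finset.sum_eq_single (Finsupp.single 1 K)]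
  · simp
  · intro s hs hne
    have h1 := h s (mem_support_iff.1 hs)
    have h0 : s 0 ≠ 0 := by
      intro h0
      refine hne ?_
      rw [h0] at h1
      ext i
      fin_cases i
      · simpa using h0
      · simpa [hp.ne'] using h1
    simp [h0]
  · intro hs
    simp [notMem_support_iff.1 hs]

theorem IsQuasiHom.eval_zero_right {K : ℕ} (hq : 0 < q) (h : IsQuasiHom q p (q * K) φ) (x : ℂ) :
    eval ![x, 0] φ = coeff (Finsupp.single 0 K) φ * x ^ K := by
  rw [eval_eq', Finset.sum_eq_single (Finsupp.single 0 K)]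
  · simp
  · intro s hs hne
    have h1 := h s (mem_support_iff.1 hs)
    have h0 : s 1 ≠ 0 := by
      intro h0
      refine hne ?_
      rw [h0] at h1
      ext i
      fin_cases i
      · simpa [hq.ne'] using h1
      · simpa using h0
    simp [h0]
  · intro hs
    simp [notMem_support_iff.1 hs]

/-- The univariate polynomial `φ(1, y)`. -/
def dehom (φ : MvPolynomial (Fin 2) ℂ) : Polynomial ℂ := aeval ![1, Polynomial.X] φ

theorem eval_dehom (φ : MvPolynomial (Fin 2) ℂ) (y : ℂ) :
    (dehom φ).eval y = eval ![1, y] φ := by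
  rw [dehom, ← Polynomial.coe_evalRingHom, map_aeval, coe_eval₂Hom, ← eval₂_id]
  congr 1
  · ext; simp
  · funext i
    fin_cases i <;> simp

theorem coeff_dehom (φ : MvPolynomial (Fin 2) ℂ) (k : ℕ) :
    (dehom φ).coeff k = ∑ s ∈ φ.support, if s 1 = k then coeff s φ else 0 := by
  rw [dehom, aeval_def, eval₂_eq', Polynomial.finsetSum_coeff]
  refine Finset.sum_congr rfl fun s _ => ?_
  simp [Fin.prod_univ_two, Polynomial.coeff_X_pow, eq_comm]

theorem IsQuasiHom.coeff_dehom {K : ℕ} (hq : 0 < q)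
    (h : IsQuasiHom q p (p * K) φ) :
    (dehom φ).coeff K = coeff (Finsupp.single 1 K) φ := by
  rw [_root_.coeff_dehom, Finset.sum_eq_single (Finsupp.single 1 K)]
  · simp
  · intro s hs hne
    refine if_neg fun h1 => hne ?_
    have h2 := h s (mem_support_iff.1 hs)
    rw [h1] at h2
    have : s 0 = 0 := by
      simpa [hq.ne'] using h2
    ext i
    fin_cases i
    · simpa using this
    · simpa using h1
  · intro hs
    simp [notMem_support_iff.1 hs]

theorem IsQuasiHom.natDegree_dehom_le {K : ℕ} (hp : 0 < p)
    (h : IsQuasiHom q p (p * K) φ) : (dehom φ).natDegree ≤ K := by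
  refine Polynomial.natDegree_le_iff_coeff_eq_zero.2 fun k hk => ?_
  rw [_root_.coeff_dehom]
  refine Finset.sum_eq_zero fun s hs => if_neg fun h1 => ?_
  have h2 := h s (mem_support_iff.1 hs)
  have : p * s 1 ≤ p * K := by omega
  have := Nat.le_of_mul_le_mul_left this hp
  omega

end QuasiHomogeneous

section HessianDeterminant

open MvPolynomial

theorem det_sum_two_of_rank_one {R : Type*} [CommRing R]
    (M : Matrix (Fin 2 ⊕ Fin 2) (Fin 2 ⊕ Fin 2) R) (A11 A12 A22 D11 D12 D22 u1 u2 v1 v2 : R)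
    (h : ∀ a b, M a b =
      (Matrix.fromBlocks !![A11, A12; A12, A22] !![u1 * v1, u1 * v2; u2 * v1, u2 * v2]
        !![u1 * v1, u2 * v1; u1 * v2, u2 * v2] !![D11, D12; D12, D22] :
          Matrix (Fin 2 ⊕ Fin 2) (Fin 2 ⊕ Fin 2) R) a b) :
    M.det = (A11 * A22 - A12 ^ 2) * (D11 * D22 - D12 ^ 2) -
      (D22 * v1 ^ 2 - 2 * D12 * v1 * v2 + D11 * v2 ^ 2) *
        (A22 * u1 ^ 2 - 2 * A12 * u1 * u2 + A11 * u2 ^ 2) := by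
  have hM : Matrix.reindex finSumFinEquiv finSumFinEquiv M =
      !![A11, A12, u1 * v1, u1 * v2; A12, A22, u2 * v1, u2 * v2;
        u1 * v1, u2 * v1, D11, D12; u1 * v2, u2 * v2, D12, D22] := by
    rw [Matrix.ext h]
    ext i j
    fin_cases i <;> fin_cases j <;> rfl
  rw [← Matrix.det_reindex_self finSumFinEquiv M, hM, Matrix.det_succ_row_zero]
  simp [Fin.sum_univ_succ, Matrix.det_fin_three, Matrix.submatrix, Fin.succAbove]
  ring

/-- The closed form of the logarithmic mixed Hessian determinant at a critical point: `f`, `h`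
and their indexed versions are the values of `f` and of the logarithmic derivatives of `f`, `g`,
while `k`, `G` and its indexed versions are the conjugate data of `f` and `g`. -/
def hessForm {R : Type*} [CommRing R]
    (d₁ d₂ β f f1 f2 f11 f12 f22 h1 h2 k G G1 G2 G11 G12 G22 : R) : R :=
  ((G * f11 + (d₁ - 1) * (β * k * h1 - G * f1)) * (G * f22 + (d₂ - 1) * (β * k * h2 - G * f2)) -
      (G * f12) ^ 2) * (f ^ 2 * (G11 * G22 - G12 ^ 2)) -
    f * (G22 * G1 ^ 2 - 2 * G12 * G1 * G2 + G11 * G2 ^ 2) *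
      ((G * f22 + (d₂ - 1) * (β * k * h2 - G * f2)) * f1 ^ 2 - 2 * (G * f12) * f1 * f2 +
        (G * f11 + (d₁ - 1) * (β * k * h1 - G * f1)) * f2 ^ 2)

theorem hessForm_smul {R : Type*} [CommRing R] (l μ l' μ' β β' : R)
    (d₁ d₂ f f1 f2 f11 f12 f22 h1 h2 k G G1 G2 G11 G12 G22 : R)
    (hβ : β * (l' * μ) = β' * (l * μ')) :
    hessForm d₁ d₂ β (l * f) (l * f1) (l * f2) (l * f11) (l * f12) (l * f22) (μ * h1) (μ * h2)
      (l' * k) (μ' * G) (μ' * G1) (μ' * G2) (μ' * G11) (μ' * G12) (μ' * G22) =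
    (l * μ') ^ 4 *
      hessForm d₁ d₂ β' f f1 f2 f11 f12 f22 h1 h2 k G G1 G2 G11 G12 G22 := by
  have e : ∀ h, β * (l' * k) * (μ * h) = (l * μ') * (β' * k * h) := fun h => by
    linear_combination k * h * hβ
  simp only [hessForm, e]
  ring

/-- The logarithmic second derivative `z_j z_k ∂²/∂z_j∂z_k`. -/
def logHess {σ : Type*} (j k : σ) (φ : MvPolynomial σ ℂ) : MvPolynomial σ ℂ :=
  X j * X k * pderiv j (pderiv k φ)

theorem logHess_of_ne {σ : Type*} {j k : σ} (h : j ≠ k) (φ : MvPolynomial σ ℂ) :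
    logHess j k φ = theta j (theta k φ) := by
  classical
  rw [logHess, X_mul_X_mul_pderiv_pderiv, if_neg h, sub_zero]

theorem logHess_self {σ : Type*} (j : σ) (φ : MvPolynomial σ ℂ) :
    logHess j j φ = theta j (theta j φ) - theta j φ := by
  classical
  rw [logHess, X_mul_X_mul_pderiv_pderiv, if_pos rfl]

/-- `hessForm` at the data of `f`, `g` in `z` and the conjugate data in `u`. -/
def critForm (d₁ d₂ : ℕ) (f g : MvPolynomial (Fin 2) ℂ) (β : ℂ) (z u : Fin 2 → ℂ) : ℂ :=
  hessForm (d₁ : ℂ) (d₂ : ℂ) β (eval z f) (eval z (theta 0 f)) (eval z (theta 1 f))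
    (eval z (logHess 0 0 f)) (eval z (logHess 0 1 f)) (eval z (logHess 1 1 f))
    (eval z (theta 0 g)) (eval z (theta 1 g)) ((starRingEnd ℂ) (eval u f))
    ((starRingEnd ℂ) (eval u g)) ((starRingEnd ℂ) (eval u (theta 0 g)))
    ((starRingEnd ℂ) (eval u (theta 1 g))) ((starRingEnd ℂ) (eval u (logHess 0 0 g)))
    ((starRingEnd ℂ) (eval u (logHess 0 1 g))) ((starRingEnd ℂ) (eval u (logHess 1 1 g)))

/-- The polynomial in `z, z̄` representing `f ḡ + c₁ z₁ ^ d₁ + c₂ z₂ ^ d₂`. -/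
def deformation (d₁ d₂ : ℕ) (f g : MvPolynomial (Fin 2) ℂ) (c₁ c₂ : ℂ) :
    MvPolynomial (Fin 2 ⊕ Fin 2) ℂ :=
  rename Sum.inl f * rename Sum.inr (map (starRingEnd ℂ) g) +
    (C c₁ * X (.inl 0) ^ d₁ + C c₂ * X (.inl 1) ^ d₂)

theorem theta_inl_rename_inl (j : Fin 2) (f : MvPolynomial (Fin 2) ℂ) :
    theta (.inl j) (rename Sum.inl f : MvPolynomial (Fin 2 ⊕ Fin 2) ℂ) =
      rename Sum.inl (theta j f) := by
  rw [theta_apply, theta_apply, map_mul, rename_X, pderiv_rename Sum.inl_injective]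

theorem theta_inr_rename_inr (j : Fin 2) (f : MvPolynomial (Fin 2) ℂ) :
    theta (.inr j) (rename Sum.inr f : MvPolynomial (Fin 2 ⊕ Fin 2) ℂ) =
      rename Sum.inr (theta j f) := by
  rw [theta_apply, theta_apply, map_mul, rename_X, pderiv_rename Sum.inr_injective]

theorem theta_inr_rename_inl (j : Fin 2) (f : MvPolynomial (Fin 2) ℂ) :
    theta (.inr j) (rename Sum.inl f : MvPolynomial (Fin 2 ⊕ Fin 2) ℂ) = 0 := by
  classical
  rw [theta_apply, pderiv_eq_zero_of_notMem_vars, mul_zero]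
  intro h
  simpa using vars_rename _ _ h

theorem theta_inl_rename_inr (j : Fin 2) (f : MvPolynomial (Fin 2) ℂ) :
    theta (.inl j) (rename Sum.inr f : MvPolynomial (Fin 2 ⊕ Fin 2) ℂ) = 0 := by
  classical
  rw [theta_apply, pderiv_eq_zero_of_notMem_vars, mul_zero]
  intro h
  simpa using vars_rename _ _ h

theorem theta_map (j : Fin 2) (f : MvPolynomial (Fin 2) ℂ) :
    theta j (map (starRingEnd ℂ) f) = map (starRingEnd ℂ) (theta j f) := by
  rw [theta_apply, theta_apply, map_mul, map_X, pderiv_map]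

theorem theta_X_pow_self {σ : Type*} (j : σ) (d : ℕ) :
    theta j (X j ^ d : MvPolynomial σ ℂ) = C (d : ℂ) * X j ^ d := by
  rw [theta_apply, pderiv_pow, pderiv_X_self]
  rcases d with _ | d
  · simp
  · simp [pow_succ]; ring

theorem theta_X_pow_of_ne {σ : Type*} {i j : σ} (h : i ≠ j) (d : ℕ) :
    theta i (X j ^ d : MvPolynomial σ ℂ) = 0 := by
  rw [theta_apply, pderiv_pow, pderiv_X_of_ne h.symm, mul_zero, mul_zero]

theorem eval_withConj_rename_inl (z : Fin 2 → ℂ) (f : MvPolynomial (Fin 2) ℂ) :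
    eval (withConj z) (rename Sum.inl f) = eval z f := by
  rw [eval_rename]
  rfl

theorem eval_withConj_rename_inr (z : Fin 2 → ℂ) (f : MvPolynomial (Fin 2) ℂ) :
    eval (withConj z) (rename Sum.inr (map (starRingEnd ℂ) f)) =
      (starRingEnd ℂ) (eval z f) := by
  rw [eval_rename, eval_map]
  change _ = (starRingEnd ℂ) (eval₂ (RingHom.id ℂ) z f)
  rw [eval₂_comp_left]
  rfl

section

variable (d₁ d₂ : ℕ) (f g : MvPolynomial (Fin 2) ℂ) (c₁ c₂ : ℂ)

theorem eval_deformation (z : Fin 2 → ℂ) : eval (withConj z) (deformation d₁ d₂ f g c₁ c₂) =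
    eval z f * (starRingEnd ℂ) (eval z g) + (c₁ * z 0 ^ d₁ + c₂ * z 1 ^ d₂) := by
  simp only [deformation, map_add, map_mul, eval_withConj_rename_inl, eval_withConj_rename_inr,
    map_pow, eval_C, eval_X]
  rfl

theorem theta_inl_zero_deformation :
    theta (.inl 0) (deformation d₁ d₂ f g c₁ c₂) =
      deformation d₁ d₂ (theta 0 f) g (d₁ * c₁) 0 := by
  simp only [deformation, map_add, Derivation.leibniz, theta_inl_rename_inl,
    theta_inl_rename_inr, derivation_C, theta_X_pow_self, smul_eq_mul, C_mul, map_zero,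
    mul_zero, zero_mul,
    theta_X_pow_of_ne (show (Sum.inl 0 : Fin 2 ⊕ Fin 2) ≠ .inl 1 by simp)]
  ring

theorem theta_inl_one_deformation :
    theta (.inl 1) (deformation d₁ d₂ f g c₁ c₂) =
      deformation d₁ d₂ (theta 1 f) g 0 (d₂ * c₂) := by
  simp only [deformation, map_add, Derivation.leibniz, theta_inl_rename_inl,
    theta_inl_rename_inr, derivation_C, theta_X_pow_self, smul_eq_mul, C_mul, map_zero,
    mul_zero, zero_mul,
    theta_X_pow_of_ne (show (Sum.inl 1 : Fin 2 ⊕ Fin 2) ≠ .inl 0 by simp)]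
  ring

theorem theta_inr_deformation (j : Fin 2) :
    theta (.inr j) (deformation d₁ d₂ f g c₁ c₂) =
      deformation d₁ d₂ f (theta j g) 0 0 := by
  simp only [deformation, map_add, Derivation.leibniz, theta_inr_rename_inl,
    theta_inr_rename_inr, theta_map, derivation_C, smul_eq_mul, map_zero, mul_zero, zero_mul,
    theta_X_pow_of_ne (show (Sum.inr j : Fin 2 ⊕ Fin 2) ≠ .inl 0 by simp),
    theta_X_pow_of_ne (show (Sum.inr j : Fin 2 ⊕ Fin 2) ≠ .inl 1 by simp)]
  ring

theorem det_mixedHessian_deformation (β : ℂ) (w : Fin 2 → ℂ)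
    (h0 : β * (starRingEnd ℂ) (eval w f) * eval w (theta 0 g) =
      (starRingEnd ℂ) (eval w g) * eval w (theta 0 f) + d₁ * c₁ * w 0 ^ d₁)
    (h1 : β * (starRingEnd ℂ) (eval w f) * eval w (theta 1 g) =
      (starRingEnd ℂ) (eval w g) * eval w (theta 1 f) + d₂ * c₂ * w 1 ^ d₂) :
    (∏ a, withConj w a) ^ 2 *
      (mixedHessian (fun z => eval (withConj z) (deformation d₁ d₂ f g c₁ c₂)) w).det =
    critForm d₁ d₂ f g β w w := by
  set K := deformation d₁ d₂ f g c₁ c₂ with hK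
  set H := mixedHessian (fun z => eval (withConj z) K) w with hH
  have hN : (∏ a, withConj w a) ^ 2 * H.det =
      (Matrix.diagonal (withConj w) * H * Matrix.diagonal (withConj w)).det := by
    rw [Matrix.det_mul, Matrix.det_mul, Matrix.det_diagonal]
    ring
  have hent : ∀ a b, (Matrix.diagonal (withConj w) * H * Matrix.diagonal (withConj w)) a b =
      eval (withConj w) (theta a (theta b K) - if a = b then theta b K else 0) := by
    intro a b
    rw [← X_mul_X_mul_pderiv_pderiv, Matrix.mul_diagonal, Matrix.diagonal_mul, hH,
      mixedHessian_eval_withConj]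
    simp only [Matrix.of_apply, map_mul, eval_X]
    ring
  rw [hN, det_sum_two_of_rank_one _
    ((starRingEnd ℂ) (eval w g) * eval w (logHess 0 0 f) + (d₁ - 1) *
      (β * (starRingEnd ℂ) (eval w f) * eval w (theta 0 g) -
        (starRingEnd ℂ) (eval w g) * eval w (theta 0 f)))
    ((starRingEnd ℂ) (eval w g) * eval w (logHess 0 1 f))
    ((starRingEnd ℂ) (eval w g) * eval w (logHess 1 1 f) + (d₂ - 1) *
      (β * (starRingEnd ℂ) (eval w f) * eval w (theta 1 g) -
        (starRingEnd ℂ) (eval w g) * eval w (theta 1 f)))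
    (eval w f * (starRingEnd ℂ) (eval w (logHess 0 0 g)))
    (eval w f * (starRingEnd ℂ) (eval w (logHess 0 1 g)))
    (eval w f * (starRingEnd ℂ) (eval w (logHess 1 1 g)))
    (eval w (theta 0 f)) (eval w (theta 1 f))
    ((starRingEnd ℂ) (eval w (theta 0 g))) ((starRingEnd ℂ) (eval w (theta 1 g)))]
  · simp only [critForm, hessForm]
    ring
  · intro a b
    rw [hent, h0, h1]
    rcases a with a | a <;> rcases b with b | b <;> fin_cases a <;> fin_cases b <;>
      simp [hK, theta_inl_zero_deformation, theta_inl_one_deformation, theta_inr_deformation,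
        eval_deformation, logHess_self, logHess_of_ne, theta_comm (1 : Fin 2) 0] <;> ring

end

end HessianDeterminant

section Nonvanishing

open MvPolynomial

/-- The logarithmic gradients of `f ḡ` do not all vanish at a point of the torus. -/
def TorusNondegenerate (f g : MvPolynomial (Fin 2) ℂ) : Prop :=
  ∀ z : Fin 2 → ℂ, z 0 ≠ 0 → z 1 ≠ 0 →
    ¬ ∀ j, (starRingEnd ℂ) (eval z g) * eval z (theta j f) = 0 ∧
      eval z f * (starRingEnd ℂ) (eval z (theta j g)) = 0

theorem TorusNondegenerate.symm {f g : MvPolynomial (Fin 2) ℂ} (h : TorusNondegenerate f g) :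
    TorusNondegenerate g f := by
  intro z h0 h1 hz
  refine h z h0 h1 fun j => ?_
  obtain ⟨h2, h3⟩ := hz j
  constructor
  · simpa using congrArg (starRingEnd ℂ) h3
  · simpa using congrArg (starRingEnd ℂ) h2

theorem TorusNondegenerate.not_both {f g : MvPolynomial (Fin 2) ℂ} (h : TorusNondegenerate f g)
    {z : Fin 2 → ℂ} (h0 : z 0 ≠ 0) (h1 : z 1 ≠ 0) (hf : eval z f = 0) : eval z g ≠ 0 := by
  intro hg
  exact h z h0 h1 fun j => by simp [hf, hg]

theorem TorusNondegenerate.theta_ne_zero {q p D : ℕ} (hp : 0 < p) (hq : 0 < q)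
    {f g : MvPolynomial (Fin 2) ℂ} (h : TorusNondegenerate f g) (hf : IsQuasiHom q p D f)
    {z : Fin 2 → ℂ} (h0 : z 0 ≠ 0) (h1 : z 1 ≠ 0) (hz : eval z f = 0) (j : Fin 2) :
    eval z (theta j f) ≠ 0 := by
  intro hj
  have he := hf.euler_eval z
  rw [hz] at he
  have hp' : (p : ℂ) ≠ 0 := by exact_mod_cast hp.ne'
  have hq' : (q : ℂ) ≠ 0 := by exact_mod_cast hq.ne'
  have : eval z (theta 0 f) = 0 ∧ eval z (theta 1 f) = 0 := by
    fin_cases j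
    · have hj' : eval z (theta 0 f) = 0 := hj
      rw [hj'] at he
      exact ⟨hj', by simpa [hp'] using he⟩
    · have hj' : eval z (theta 1 f) = 0 := hj
      rw [hj'] at he
      exact ⟨by simpa [hq'] using he, hj'⟩
  refine h z h0 h1 fun i => ?_
  fin_cases i
  · exact ⟨by simp [this.1], by simp [hz]⟩
  · exact ⟨by simp [this.2], by simp [hz]⟩

theorem dehom_theta_one (φ : MvPolynomial (Fin 2) ℂ) :
    dehom (theta 1 φ) = Polynomial.X * Polynomial.derivative (dehom φ) := by
  induction φ using MvPolynomial.induction_on with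
  | C a => simp [dehom]
  | add a b ha hb =>
    simp only [dehom, map_add] at *
    rw [ha, hb, mul_add]
  | mul_X a i ha =>
    simp only [dehom, map_add, Derivation.leibniz, smul_eq_mul, map_mul] at *
    rw [ha]
    fin_cases i
    · simp [theta_apply]
    · simp [theta_apply]
      ring

section

variable {q p M : ℕ} {f g : MvPolynomial (Fin 2) ℂ}

theorem IsQuasiHom.natDegree_dehom (hp : 0 < p) (hq : 0 < q)
    (hf : IsQuasiHom q p (p * q * M) f) (hc : coeff (Finsupp.single 1 (q * M)) f ≠ 0) :
    (dehom f).natDegree = q * M := by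
  rw [mul_assoc] at hf
  refine le_antisymm (hf.natDegree_dehom_le hp) (Polynomial.le_natDegree_of_ne_zero ?_)
  rwa [hf.coeff_dehom hq]

theorem IsQuasiHom.eval_one_zero (hq : 0 < q) (hf : IsQuasiHom q p (p * q * M) f) :
    eval ![1, 0] f = coeff (Finsupp.single 0 (p * M)) f := by
  rw [mul_comm p q, mul_assoc] at hf
  rw [hf.eval_zero_right hq, one_pow, mul_one]

theorem IsQuasiHom.exists_root (hp : 0 < p) (hq : 0 < q) (hM : 0 < M)
    (hf : IsQuasiHom q p (p * q * M) f) (hc0 : coeff (Finsupp.single 0 (p * M)) f ≠ 0)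
    (hc1 : coeff (Finsupp.single 1 (q * M)) f ≠ 0) :
    ∃ y : ℂ, y ≠ 0 ∧ eval ![1, y] f = 0 := by
  have hd := hf.natDegree_dehom hp hq hc1
  obtain ⟨y, hy⟩ := IsAlgClosed.exists_root (dehom f) (by
    intro h
    rw [Polynomial.natDegree_eq_of_degree_eq_some h] at hd
    exact (Nat.mul_pos hq hM).ne hd)
  have hy' : eval ![1, y] f = 0 := by rw [← eval_dehom]; exact hy
  refine ⟨y, ?_, hy'⟩
  rintro rfl
  exact hc0 (by rw [← hf.eval_one_zero hq, hy'])

theorem IsQuasiHom.card_roots (hp : 0 < p) (hq : 0 < q)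
    (hf : IsQuasiHom q p (p * q * M) f) (hfg : TorusNondegenerate f g)
    (hc0 : coeff (Finsupp.single 0 (p * M)) f ≠ 0)
    (hc1 : coeff (Finsupp.single 1 (q * M)) f ≠ 0) :
    (dehom f).roots.toFinset.card = q * M := by
  classical
  have hd := hf.natDegree_dehom hp hq hc1
  have h0 : dehom f ≠ 0 := by
    rintro h
    have h1 := hf.eval_one_zero hq
    rw [← eval_dehom, h, Polynomial.eval_zero] at h1
    exact hc0 h1.symm
  rw [Multiset.toFinset_card_of_nodup, ← (IsAlgClosed.splits (dehom f)).natDegree_eq_card_roots, hd]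
  refine Multiset.nodup_iff_count_le_one.2 fun x => ?_
  rw [Polynomial.count_roots]
  by_contra! hcon
  obtain ⟨h1, h2⟩ := (Polynomial.one_lt_rootMultiplicity_iff_isRoot h0).1 hcon
  have h3 : eval ![1, x] f = 0 := by rw [← eval_dehom]; exact h1
  have h4 : eval ![1, x] (theta 1 f) = 0 := by
    rw [← eval_dehom, dehom_theta_one, Polynomial.eval_mul, h2.eq_zero, mul_zero]
  have hx : x ≠ 0 := by
    rintro rfl
    exact hc0 (by rw [← hf.eval_one_zero hq, h3])
  exact hfg.theta_ne_zero hp hq hf (z := ![1, x]) (by simp) (by simpa using hx) h3 1 h4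

end

theorem exists_eval_ne_zero {σ : Type*} {φ : MvPolynomial σ ℂ} (h : φ ≠ 0) :
    ∃ z, eval z φ ≠ 0 := by
  by_contra! hcon
  exact h (MvPolynomial.funext fun z => by simp [hcon z])

theorem theta_ne_zero_of_coeff {j : Fin 2} {N : ℕ} (hN : 0 < N) {φ : MvPolynomial (Fin 2) ℂ}
    (h : coeff (Finsupp.single j N) φ ≠ 0) : theta j φ ≠ 0 := by
  intro h0
  have := congrArg (coeff (Finsupp.single j N)) h0
  rw [coeff_theta] at this
  simp [h, hN.ne'] at this

/-- `hessForm` where `G = 0`. -/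
theorem hessForm_zero {R : Type*} [CommRing R]
    (d₁ d₂ β f f1 f2 f11 f12 f22 h1 h2 k G1 G2 G11 G12 G22 : R) :
    hessForm d₁ d₂ β f f1 f2 f11 f12 f22 h1 h2 k 0 G1 G2 G11 G12 G22 =
      β ^ 2 * ((d₁ - 1) * (d₂ - 1) * k ^ 2 * (h1 * h2 * f ^ 2) * (G11 * G22 - G12 ^ 2)) -
        β * (f * k * (G22 * G1 ^ 2 - 2 * G12 * G1 * G2 + G11 * G2 ^ 2) *
          ((d₁ - 1) * h1 * f2 ^ 2 + (d₂ - 1) * h2 * f1 ^ 2)) := by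
  simp only [hessForm]
  ring

theorem conj_euler {q p D : ℕ} {φ : MvPolynomial (Fin 2) ℂ} (h : IsQuasiHom q p D φ)
    (u : Fin 2 → ℂ) :
    (q : ℂ) * (starRingEnd ℂ) (eval u (theta 0 φ)) + p * (starRingEnd ℂ) (eval u (theta 1 φ)) =
      D * (starRingEnd ℂ) (eval u φ) := by
  simpa using congrArg (starRingEnd ℂ) (h.euler_eval u)

variable {q p m n : ℕ} {f g : MvPolynomial (Fin 2) ℂ}

theorem exists_mul_ne_zero (hp : 0 < p) (hq : 0 < q) (hn : 0 < n) (hmn : n < m)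
    (hf : IsQuasiHom q p (p * q * m) f) (hg : IsQuasiHom q p (p * q * n) g)
    (ha₁ : coeff (Finsupp.single 0 (p * m)) f ≠ 0) (ha₂ : coeff (Finsupp.single 1 (q * m)) f ≠ 0)
    (hb₂ : coeff (Finsupp.single 1 (q * n)) g ≠ 0) (hfg : TorusNondegenerate f g)
    (hd : 1 < q * (m - n)) :
    ∃ z, eval z f ≠ 0 ∧ ((p * (m - n) : ℕ) - 1 : ℂ) * eval z (theta 0 g) * eval z (theta 1 f) ^ 2 +
      ((q * (m - n) : ℕ) - 1 : ℂ) * eval z (theta 1 g) * eval z (theta 0 f) ^ 2 ≠ 0 := by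
  have hp' : (p : ℂ) ≠ 0 := by exact_mod_cast hp.ne'
  have hq' : (q : ℂ) ≠ 0 := by exact_mod_cast hq.ne'
  set e₁ : ℂ := (p * (m - n) : ℕ) - 1
  set e₂ : ℂ := (q * (m - n) : ℕ) - 1 with he₂
  have he₂' : e₂ ≠ 0 := by
    rw [he₂, sub_ne_zero]
    exact_mod_cast hd.ne'
  have hf0 : f ≠ 0 := by
    rintro rfl
    simp at ha₁
  have hR : C e₁ * theta 0 g * theta 1 f ^ 2 + C e₂ * theta 1 g * theta 0 f ^ 2 ≠ 0 := by
    intro hR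
    set ψ : Polynomial ℂ := Polynomial.C (e₁ * q ^ 2) * dehom (theta 0 g) +
      Polynomial.C (e₂ * p ^ 2) * dehom (theta 1 g) with hψ
    have hg' : ∀ j, IsQuasiHom q p (p * (q * n)) (theta j g) := fun j => by
      rw [← mul_assoc]; exact hg.logDeriv j
    have hψ0 : ψ ≠ 0 := by
      intro h
      have h1 := congrArg (fun P => Polynomial.coeff P (q * n)) h
      simp only [hψ, Polynomial.coeff_add, Polynomial.coeff_C_mul, (hg' _).coeff_dehom hq,
        coeff_theta, Polynomial.coeff_zero] at h1
      simp [-Finsupp.single_mul, he₂', hp', hq', hb₂, hn.ne'] at h1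
    have hdeg : ψ.natDegree ≤ q * n := by
      refine Polynomial.natDegree_add_le_of_degree_le
        ((Polynomial.natDegree_C_mul_le _ _).trans ?_)
        ((Polynomial.natDegree_C_mul_le _ _).trans ?_)
      · exact (hg' 0).natDegree_dehom_le hp
      · exact (hg' 1).natDegree_dehom_le hp
    refine hψ0 (Polynomial.eq_zero_of_natDegree_lt_card_of_eval_eq_zero' ψ
      (dehom f).roots.toFinset ?_ ?_)
    · intro x hx
      rw [Multiset.mem_toFinset, Polynomial.mem_roots'] at hx
      have hx0 : eval ![1, x] f = 0 := by rw [← eval_dehom]; exact hx.2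
      have hxne : x ≠ 0 := by
        rintro rfl
        exact ha₁ (by rw [← hf.eval_one_zero hq, hx0])
      have h1 := hfg.theta_ne_zero hp hq hf (z := ![1, x]) (by simp) (by simpa using hxne) hx0 1
      have h2 := congrArg (eval ![1, x]) hR
      simp only [map_add, map_mul, map_pow, eval_C, map_zero] at h2
      have h3 := hf.euler_eval ![1, x]
      rw [hx0, mul_zero] at h3
      simp only [hψ, Polynomial.eval_add, Polynomial.eval_mul, Polynomial.eval_C, eval_dehom]
      refine (mul_eq_zero.1 ?_).resolve_left (pow_ne_zero 2 h1)
      linear_combination (q : ℂ) ^ 2 * h2 + e₂ * eval ![1, x] (theta 1 g) *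
        (p * eval ![1, x] (theta 1 f) - q * eval ![1, x] (theta 0 f)) * h3
    · rw [hf.card_roots hp hq hfg ha₁ ha₂]
      exact hdeg.trans_lt (Nat.mul_lt_mul_of_pos_left hmn hq)
  obtain ⟨z, hz⟩ := exists_eval_ne_zero (mul_ne_zero hf0 hR)
  rw [map_mul] at hz
  exact ⟨z, left_ne_zero_of_mul hz, by simpa using right_ne_zero_of_mul hz⟩

theorem exists_critForm_ne_zero_of_lt (hp : 0 < p) (hn : 0 < n) (hmn : n < m) (hpq : p < q)
    (hf : IsQuasiHom q p (p * q * m) f) (hg : IsQuasiHom q p (p * q * n) g)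
    (ha₁ : coeff (Finsupp.single 0 (p * m)) f ≠ 0) (ha₂ : coeff (Finsupp.single 1 (q * m)) f ≠ 0)
    (hb₁ : coeff (Finsupp.single 0 (p * n)) g ≠ 0) (hb₂ : coeff (Finsupp.single 1 (q * n)) g ≠ 0)
    (hfg : TorusNondegenerate f g) :
    ∃ β z u, β ≠ 0 ∧ critForm (p * (m - n)) (q * (m - n)) f g β z u ≠ 0 := by
  have hq : 0 < q := hp.trans hpq
  have hp' : (p : ℂ) ≠ 0 := by exact_mod_cast hp.ne'
  have hq' : (q : ℂ) ≠ 0 := by exact_mod_cast hq.ne'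
  have hpq' : (p : ℂ) - q ≠ 0 := by
    rw [sub_ne_zero]
    exact_mod_cast hpq.ne
  have hd : 1 < q * (m - n) := by
    have h1 : 1 ≤ m - n := by omega
    have h2 := Nat.mul_le_mul_left q h1
    omega
  obtain ⟨y, hy, hyg⟩ := hg.exists_root hp hq hn hb₁ hb₂
  obtain ⟨z, hzf, hzR⟩ := exists_mul_ne_zero hp hq hn hmn hf hg ha₁ ha₂ hb₂ hfg hd
  have hu0 : (![1, y] : Fin 2 → ℂ) 0 ≠ 0 := by simp
  have hu1 : (![1, y] : Fin 2 → ℂ) 1 ≠ 0 := by simpa using hy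
  have hk := hfg.symm.not_both hu0 hu1 hyg
  have hg0 := hfg.symm.theta_ne_zero hp hq hg hu0 hu1 hyg 0
  set u : Fin 2 → ℂ := ![1, y]
  have e := conj_euler hg u
  have e0 := conj_euler (hg.logDeriv 0) u
  have e1 := conj_euler (hg.logDeriv 1) u
  rw [theta_comm (0 : Fin 2) 1] at e1
  by_contra! hcon
  have hplus := hcon 1 z u one_ne_zero
  have hminus := hcon (-1) z u (by norm_num)
  have hk' : (starRingEnd ℂ) (eval u f) ≠ 0 := by simpa using hk
  have hgz : (starRingEnd ℂ) (eval u (theta 0 g)) ≠ 0 := by simpa using hg0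
  simp only [critForm, hyg, map_zero, hessForm_zero, logHess_self, map_sub,
    logHess_of_ne (show (0 : Fin 2) ≠ 1 by simp), theta_comm (0 : Fin 2) 1] at hplus hminus e
  set k := (starRingEnd ℂ) (eval u f)
  set G0 := (starRingEnd ℂ) (eval u (theta 0 g))
  set G1 := (starRingEnd ℂ) (eval u (theta 1 g))
  set T00 := (starRingEnd ℂ) (eval u (theta 0 (theta 0 g)))
  set T10 := (starRingEnd ℂ) (eval u (theta 1 (theta 0 g)))
  set T11 := (starRingEnd ℂ) (eval u (theta 1 (theta 1 g)))
  have hG1 : G1 = -(q * G0) / p := by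
    field_simp
    linear_combination e
  have hT10 : T10 = ((p * q * n : ℕ) * G0 - q * T00) / p := by
    field_simp
    linear_combination e0
  have hT11 : T11 = ((p * q * n : ℕ) * G1 - q * T10) / p := by
    field_simp
    linear_combination e1
  have hQ : (T11 - G1) * G0 ^ 2 - 2 * T10 * G0 * G1 + (T00 - G0) * G1 ^ 2 =
      q * (p - q) / p ^ 2 * G0 ^ 3 := by
    rw [hT11, hT10, hG1]
    field_simp
    ring
  refine mul_ne_zero (mul_ne_zero (mul_ne_zero hzf hk') ?_) hzR
    (by linear_combination -(hplus - hminus) / 2 :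
      eval z f * k * ((T11 - G1) * G0 ^ 2 - 2 * T10 * G0 * G1 + (T00 - G0) * G1 ^ 2) *
        (((p * (m - n) : ℕ) - 1 : ℂ) * eval z (theta 0 g) * eval z (theta 1 f) ^ 2 +
          ((q * (m - n) : ℕ) - 1 : ℂ) * eval z (theta 1 g) * eval z (theta 0 f) ^ 2) = 0)
  rw [hQ]
  exact mul_ne_zero (div_ne_zero (mul_ne_zero hq' hpq') (pow_ne_zero 2 hp')) (pow_ne_zero 3 hgz)

/-- At a root of a homogeneous polynomial the logarithmic Hessian is nondegenerate. -/
theorem logHess_det_of_eval_eq_zero {N : ℕ} {φ : MvPolynomial (Fin 2) ℂ} (hp : 0 < p)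
    (h : IsQuasiHom p p (p * p * N) φ) {u : Fin 2 → ℂ} (hu : eval u φ = 0) :
    eval u (logHess 0 0 φ) * eval u (logHess 1 1 φ) - eval u (logHess 0 1 φ) ^ 2 =
      -((p * N : ℕ) - 1) ^ 2 * eval u (theta 0 φ) ^ 2 := by
  have hp' : (p : ℂ) ≠ 0 := by exact_mod_cast hp.ne'
  have e := h.euler_eval u
  have e0 := (h.logDeriv 0).euler_eval u
  have e1 := (h.logDeriv 1).euler_eval u
  rw [theta_comm (0 : Fin 2) 1] at e1
  simp only [logHess_self, map_sub, logHess_of_ne (show (0 : Fin 2) ≠ 1 by simp),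
    theta_comm (0 : Fin 2) 1, hu] at *
  set G0 := eval u (theta 0 φ)
  set G1 := eval u (theta 1 φ)
  set T00 := eval u (theta 0 (theta 0 φ))
  set T10 := eval u (theta 1 (theta 0 φ))
  set T11 := eval u (theta 1 (theta 1 φ))
  push_cast at *
  have hG1 : G1 = -G0 := mul_left_cancel₀ hp' (by linear_combination e)
  have hT00 : T00 = p * N * G0 - T10 := mul_left_cancel₀ hp' (by linear_combination e0)
  have hT11 : T11 = p * N * G1 - T10 := mul_left_cancel₀ hp' (by linear_combination e1)
  rw [hT00, hT11, hG1]
  ring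

theorem exists_critForm_ne_zero_of_two_le (hp : 0 < p) (hn : 0 < n)
    (hd : 2 ≤ p * (m - n)) (hN : 2 ≤ p * n)
    (hg : IsQuasiHom p p (p * p * n) g)
    (ha₁ : coeff (Finsupp.single 0 (p * m)) f ≠ 0)
    (hb₁ : coeff (Finsupp.single 0 (p * n)) g ≠ 0) (hb₂ : coeff (Finsupp.single 1 (p * n)) g ≠ 0)
    (hfg : TorusNondegenerate f g) :
    ∃ β z u, β ≠ 0 ∧ critForm (p * (m - n)) (p * (m - n)) f g β z u ≠ 0 := by
  obtain ⟨y, hy, hyg⟩ := hg.exists_root hp hp hn hb₁ hb₂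
  have hf0 : f ≠ 0 := by
    rintro rfl
    simp at ha₁
  obtain ⟨z, hz⟩ := exists_eval_ne_zero (mul_ne_zero (mul_ne_zero hf0
    (theta_ne_zero_of_coeff (Nat.mul_pos hp hn) hb₁))
    (theta_ne_zero_of_coeff (Nat.mul_pos hp hn) hb₂))
  rw [map_mul, map_mul, mul_ne_zero_iff, mul_ne_zero_iff] at hz
  obtain ⟨⟨hzf, hz0⟩, hz1⟩ := hz
  have hu0 : (![1, y] : Fin 2 → ℂ) 0 ≠ 0 := by simp
  have hu1 : (![1, y] : Fin 2 → ℂ) 1 ≠ 0 := by simpa using hy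
  have hk := hfg.symm.not_both hu0 hu1 hyg
  have hg0 := hfg.symm.theta_ne_zero hp hp hg hu0 hu1 hyg 0
  have hΔ := logHess_det_of_eval_eq_zero hp hg hyg
  set u : Fin 2 → ℂ := ![1, y]
  refine ⟨1, z, u, one_ne_zero, ?_⟩
  have hΔ' := congrArg (starRingEnd ℂ) hΔ
  have e := conj_euler hg u
  have e0 := conj_euler (hg.logDeriv 0) u
  have e1 := conj_euler (hg.logDeriv 1) u
  rw [theta_comm (0 : Fin 2) 1] at e1
  have hp' : (p : ℂ) ≠ 0 := by exact_mod_cast hp.ne'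
  have hk' : (starRingEnd ℂ) (eval u f) ≠ 0 := by simpa using hk
  have hgz : (starRingEnd ℂ) (eval u (theta 0 g)) ≠ 0 := by simpa using hg0
  have hd' : ((p * (m - n) : ℕ) : ℂ) - 1 ≠ 0 := by
    rw [sub_ne_zero]
    exact_mod_cast (by omega : p * (m - n) ≠ 1)
  have hN' : ((p * n : ℕ) : ℂ) - 1 ≠ 0 := by
    rw [sub_ne_zero]
    exact_mod_cast (by omega : p * n ≠ 1)
  simp only [map_mul, map_sub, map_neg, map_pow, map_natCast, map_one] at hΔ'
  simp only [critForm, hyg, map_zero, hessForm_zero]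
  rw [hΔ']
  simp only [hyg, map_zero, logHess_self, map_sub, logHess_of_ne (show (0 : Fin 2) ≠ 1 by simp),
    theta_comm (0 : Fin 2) 1] at e ⊢
  set k := (starRingEnd ℂ) (eval u f)
  set G0 := (starRingEnd ℂ) (eval u (theta 0 g))
  set G1 := (starRingEnd ℂ) (eval u (theta 1 g))
  set T00 := (starRingEnd ℂ) (eval u (theta 0 (theta 0 g)))
  set T10 := (starRingEnd ℂ) (eval u (theta 1 (theta 0 g)))
  set T11 := (starRingEnd ℂ) (eval u (theta 1 (theta 1 g)))
  push_cast at *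
  have hG1 : G1 = -G0 := mul_left_cancel₀ hp' (by linear_combination e)
  have hT00 : T00 = p * n * G0 - T10 := mul_left_cancel₀ hp' (by linear_combination e0)
  have hT11 : T11 = p * n * G1 - T10 := mul_left_cancel₀ hp' (by linear_combination e1)
  have hQ : (T11 - G1) * G0 ^ 2 - 2 * T10 * G0 * G1 + (T00 - G0) * G1 ^ 2 = 0 := by
    rw [hT00, hT11, hG1]
    ring
  rw [hQ, mul_zero, zero_mul, mul_zero, sub_zero, one_pow, one_mul]
  refine mul_ne_zero (mul_ne_zero (mul_ne_zero (mul_ne_zero hd' hd') (pow_ne_zero 2 hk'))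
    (mul_ne_zero (mul_ne_zero hz0 hz1) (pow_ne_zero 2 hzf))) ?_
  exact mul_ne_zero (neg_ne_zero.2 (pow_ne_zero 2 hN')) (pow_ne_zero 2 hgz)

theorem exists_logHess_det_ne_zero {N : ℕ} {φ ψ : MvPolynomial (Fin 2) ℂ} (hN : 2 ≤ N)
    (h : IsQuasiHom 1 1 (1 * 1 * N) φ) (hc0 : coeff (Finsupp.single 0 (1 * N)) φ ≠ 0)
    (hc1 : coeff (Finsupp.single 1 (1 * N)) φ ≠ 0) (hφ : TorusNondegenerate φ ψ) :
    ∃ z, eval z φ ≠ 0 ∧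
      eval z (logHess 0 0 φ) * eval z (logHess 1 1 φ) - eval z (logHess 0 1 φ) ^ 2 ≠ 0 := by
  obtain ⟨y, hy, hy0⟩ := h.exists_root one_pos one_pos (by omega) hc0 hc1
  have hφ0 : φ ≠ 0 := by
    rintro rfl
    simp at hc0
  have hne : logHess 0 0 φ * logHess 1 1 φ - logHess 0 1 φ ^ 2 ≠ 0 := by
    intro h0
    have h1 := congrArg (eval ![1, y]) h0
    rw [map_sub, map_mul, map_pow, map_zero, logHess_det_of_eval_eq_zero one_pos h hy0] at h1
    refine mul_ne_zero (neg_ne_zero.2 (pow_ne_zero 2 ?_)) (pow_ne_zero 2 ?_) h1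
    · rw [sub_ne_zero]
      exact_mod_cast (by omega : 1 * N ≠ 1)
    · exact hφ.theta_ne_zero one_pos one_pos h (by simp) (by simpa using hy) hy0 0
  obtain ⟨z, hz⟩ := exists_eval_ne_zero (mul_ne_zero hφ0 hne)
  rw [map_mul] at hz
  exact ⟨z, left_ne_zero_of_mul hz, by simpa using right_ne_zero_of_mul hz⟩

theorem critForm_one_one {M N : ℕ} (hf : IsQuasiHom 1 1 (1 * 1 * M) f)
    (hg : IsQuasiHom 1 1 (1 * 1 * N) g) (β : ℂ) (z u : Fin 2 → ℂ) :
    (M - 1 : ℂ) * (N - 1) * critForm 1 1 f g β z u =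
      -(M + N - 1) * eval z f ^ 2 * (starRingEnd ℂ) (eval u g) ^ 2 *
        (eval z (logHess 0 0 f) * eval z (logHess 1 1 f) - eval z (logHess 0 1 f) ^ 2) *
        (starRingEnd ℂ) (eval u (logHess 0 0 g) * eval u (logHess 1 1 g) -
          eval u (logHess 0 1 g) ^ 2) := by
  have a := hf.euler_eval z
  have a0 := (hf.logDeriv 0).euler_eval z
  have a1 := (hf.logDeriv 1).euler_eval z
  have e := conj_euler hg u
  have e0 := conj_euler (hg.logDeriv 0) u
  have e1 := conj_euler (hg.logDeriv 1) u
  rw [theta_comm (0 : Fin 2) 1] at a1 e1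
  simp only [critForm, hessForm, logHess_self, map_sub, map_mul, map_pow,
    logHess_of_ne (show (0 : Fin 2) ≠ 1 by simp), theta_comm (0 : Fin 2) 1]
  set F := eval z f
  set F0 := eval z (theta 0 f)
  set F1 := eval z (theta 1 f)
  set S00 := eval z (theta 0 (theta 0 f))
  set S10 := eval z (theta 1 (theta 0 f))
  set S11 := eval z (theta 1 (theta 1 f))
  set G := (starRingEnd ℂ) (eval u g)
  set G0 := (starRingEnd ℂ) (eval u (theta 0 g))
  set G1 := (starRingEnd ℂ) (eval u (theta 1 g))
  set T00 := (starRingEnd ℂ) (eval u (theta 0 (theta 0 g)))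
  set T10 := (starRingEnd ℂ) (eval u (theta 1 (theta 0 g)))
  set T11 := (starRingEnd ℂ) (eval u (theta 1 (theta 1 g)))
  push_cast at *
  have hF1 : F1 = M * F - F0 := by linear_combination a
  have hS10 : S10 = M * F0 - S00 := by linear_combination a0
  have hS11 : S11 = M * F1 - S10 := by linear_combination a1
  have hG1 : G1 = N * G - G0 := by linear_combination e
  have hT10 : T10 = N * G0 - T00 := by linear_combination e0
  have hT11 : T11 = N * G1 - T10 := by linear_combination e1
  rw [hT11, hT10, hG1, hS11, hS10, hF1]
  ring

theorem exists_critForm_ne_zero_of_linear (hmn : n < m) (hn : 2 ≤ n)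
    (hf : IsQuasiHom 1 1 (1 * 1 * m) f) (hg : IsQuasiHom 1 1 (1 * 1 * n) g)
    (ha₁ : coeff (Finsupp.single 0 (1 * m)) f ≠ 0) (ha₂ : coeff (Finsupp.single 1 (1 * m)) f ≠ 0)
    (hb₁ : coeff (Finsupp.single 0 (1 * n)) g ≠ 0) (hb₂ : coeff (Finsupp.single 1 (1 * n)) g ≠ 0)
    (hfg : TorusNondegenerate f g) :
    ∃ β z u, β ≠ 0 ∧ critForm 1 1 f g β z u ≠ 0 := by
  obtain ⟨z, hz, hz'⟩ := exists_logHess_det_ne_zero (by omega) hf ha₁ ha₂ hfg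
  obtain ⟨u, hu, hu'⟩ := exists_logHess_det_ne_zero hn hg hb₁ hb₂ hfg.symm
  refine ⟨1, z, u, one_ne_zero, fun h => ?_⟩
  have h1 := critForm_one_one hf hg 1 z u
  rw [h, mul_zero] at h1
  refine mul_ne_zero (mul_ne_zero (mul_ne_zero (mul_ne_zero (neg_ne_zero.2 ?_)
    (pow_ne_zero 2 hz)) (pow_ne_zero 2 ?_)) hz') ?_ h1.symm
  · rw [sub_ne_zero]
    exact_mod_cast (by omega : m + n ≠ 1)
  · simpa using hu
  · exact (map_ne_zero _).2 hu'

theorem exists_critForm_ne_zero (hp : 0 < p) (hn : 0 < n) (hmn : n < m) (hpq : p ≤ q)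
    (hN : q = 1 → 2 ≤ n)
    (hf : IsQuasiHom q p (p * q * m) f) (hg : IsQuasiHom q p (p * q * n) g)
    (ha₁ : coeff (Finsupp.single 0 (p * m)) f ≠ 0) (ha₂ : coeff (Finsupp.single 1 (q * m)) f ≠ 0)
    (hb₁ : coeff (Finsupp.single 0 (p * n)) g ≠ 0) (hb₂ : coeff (Finsupp.single 1 (q * n)) g ≠ 0)
    (hfg : TorusNondegenerate f g) :
    ∃ β z u, β ≠ 0 ∧ critForm (p * (m - n)) (q * (m - n)) f g β z u ≠ 0 := by
  rcases hpq.lt_or_eq with h | rfl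
  · exact exists_critForm_ne_zero_of_lt hp hn hmn h hf hg ha₁ ha₂ hb₁ hb₂ hfg
  rcases le_or_gt 2 (p * (m - n)) with hd | hd
  · refine exists_critForm_ne_zero_of_two_le hp hn hd ?_ hg ha₁ hb₁ hb₂ hfg
    rcases (show p = 1 ∨ 2 ≤ p by omega) with rfl | h2
    · simpa using hN rfl
    · exact h2.trans (Nat.le_mul_of_pos_right p hn)
  · have h1 : p * (m - n) = 1 :=
      le_antisymm (by omega) (Nat.mul_pos hp (by omega))
    obtain rfl : p = 1 := Nat.eq_one_of_mul_eq_one_right h1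
    rw [h1]
    exact exists_critForm_ne_zero_of_linear hmn (hN rfl) hf hg ha₁ ha₂ hb₁ hb₂ hfg

theorem critForm_quasiHom (hf : IsQuasiHom q p (p * q * m) f) (hg : IsQuasiHom q p (p * q * n) g)
    {c e β β' : ℂ} (hβ : β * ((starRingEnd ℂ) e ^ (p * q * m) * c ^ (p * q * n)) =
      β' * (c ^ (p * q * m) * (starRingEnd ℂ) e ^ (p * q * n))) (d₁ d₂ : ℕ) (z u : Fin 2 → ℂ) :
    critForm d₁ d₂ f g β ![c ^ q * z 0, c ^ p * z 1] ![e ^ q * u 0, e ^ p * u 1] =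
      (c ^ (p * q * m) * (starRingEnd ℂ) e ^ (p * q * n)) ^ 4 * critForm d₁ d₂ f g β' z u := by
  have hL : ∀ {D : ℕ} {φ : MvPolynomial (Fin 2) ℂ}, IsQuasiHom q p D φ → ∀ (c : ℂ) (v : Fin 2 → ℂ)
      (i j : Fin 2), eval ![c ^ q * v 0, c ^ p * v 1] (logHess i j φ) =
        c ^ D * eval v (logHess i j φ) := by
    intro D φ h c v i j
    by_cases hij : i = j
    · subst hij
      simp only [logHess_self, map_sub, (h.logDeriv i).eval_smul,
        ((h.logDeriv i).logDeriv i).eval_smul, mul_sub]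
    · rw [logHess_of_ne hij, ((h.logDeriv j).logDeriv i).eval_smul]
  rw [critForm, critForm, ← hessForm_smul _ _ _ _ _ _ _ _ _ _ _ _ _ _ _ _ _ _ _ _ _ _ _ hβ]
  simp only [hL hf, hL hg, hf.eval_smul, hg.eval_smul, (hf.logDeriv _).eval_smul,
    (hg.logDeriv _).eval_smul, map_mul, map_pow]

theorem eval_elim_rename_inl (z u : Fin 2 → ℂ) (φ : MvPolynomial (Fin 2) ℂ) :
    eval (Sum.elim z fun j => (starRingEnd ℂ) (u j)) (rename Sum.inl φ) = eval z φ := by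
  rw [eval_rename]
  rfl

theorem eval_elim_rename_inr (z u : Fin 2 → ℂ) (φ : MvPolynomial (Fin 2) ℂ) :
    eval (Sum.elim z fun j => (starRingEnd ℂ) (u j)) (rename Sum.inr (map (starRingEnd ℂ) φ)) =
      (starRingEnd ℂ) (eval u φ) := by
  rw [← eval_withConj_rename_inr, eval_rename, eval_rename]
  rfl

/-- The polynomial in `z, z̄` representing `critForm` with `β = 1`. -/
def critFormPoly (d₁ d₂ : ℕ) (f g : MvPolynomial (Fin 2) ℂ) : MvPolynomial (Fin 2 ⊕ Fin 2) ℂ :=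
  let F := rename (Sum.inl : Fin 2 → Fin 2 ⊕ Fin 2) (R := ℂ)
  let F' := fun φ => rename (Sum.inr : Fin 2 → Fin 2 ⊕ Fin 2) (map (starRingEnd ℂ) φ)
  hessForm (d₁ : MvPolynomial (Fin 2 ⊕ Fin 2) ℂ) d₂ 1 (F f) (F (theta 0 f)) (F (theta 1 f))
    (F (logHess 0 0 f)) (F (logHess 0 1 f)) (F (logHess 1 1 f)) (F (theta 0 g)) (F (theta 1 g))
    (F' f) (F' g) (F' (theta 0 g)) (F' (theta 1 g)) (F' (logHess 0 0 g)) (F' (logHess 0 1 g))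
    (F' (logHess 1 1 g))

theorem eval_critFormPoly (d₁ d₂ : ℕ) (f g : MvPolynomial (Fin 2) ℂ) (z u : Fin 2 → ℂ) :
    eval (Sum.elim z fun j => (starRingEnd ℂ) (u j)) (critFormPoly d₁ d₂ f g) =
      critForm d₁ d₂ f g 1 z u := by
  simp only [critFormPoly, critForm, hessForm, map_sub, map_mul, map_add, map_pow, map_natCast,
    map_one, map_ofNat, eval_elim_rename_inl, eval_elim_rename_inr]

/-- The polynomial in `z, z̄` representing `f ḡ - f̄ g`. -/
def skewPoly (f g : MvPolynomial (Fin 2) ℂ) : MvPolynomial (Fin 2 ⊕ Fin 2) ℂ :=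
  rename Sum.inl f * rename Sum.inr (map (starRingEnd ℂ) g) -
    rename Sum.inr (map (starRingEnd ℂ) f) * rename Sum.inl g

theorem eval_skewPoly (f g : MvPolynomial (Fin 2) ℂ) (z u : Fin 2 → ℂ) :
    eval (Sum.elim z fun j => (starRingEnd ℂ) (u j)) (skewPoly f g) =
      eval z f * (starRingEnd ℂ) (eval u g) - (starRingEnd ℂ) (eval u f) * eval z g := by
  simp only [skewPoly, map_sub, map_mul, eval_elim_rename_inl, eval_elim_rename_inr]

theorem critFormPoly_ne_zero (hp : 0 < p) (hn : 0 < n) (hmn : n < m) (hpq : p ≤ q)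
    (hN : q = 1 → 2 ≤ n)
    (hf : IsQuasiHom q p (p * q * m) f) (hg : IsQuasiHom q p (p * q * n) g)
    (ha₁ : coeff (Finsupp.single 0 (p * m)) f ≠ 0) (ha₂ : coeff (Finsupp.single 1 (q * m)) f ≠ 0)
    (hb₁ : coeff (Finsupp.single 0 (p * n)) g ≠ 0) (hb₂ : coeff (Finsupp.single 1 (q * n)) g ≠ 0)
    (hfg : TorusNondegenerate f g) : critFormPoly (p * (m - n)) (q * (m - n)) f g ≠ 0 := by
  have hq : 0 < q := hp.trans_le hpq
  intro h0
  have hT : ∀ z u, critForm (p * (m - n)) (q * (m - n)) f g 1 z u = 0 := fun z u => by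
    rw [← eval_critFormPoly, h0, map_zero]
  obtain ⟨β, z, u, hβ, hne⟩ :=
    exists_critForm_ne_zero hp hn hmn hpq hN hf hg ha₁ ha₂ hb₁ hb₂ hfg
  have hpos : 0 < p * q * (m - n) := Nat.mul_pos (Nat.mul_pos hp hq) (Nat.sub_pos_of_lt hmn)
  obtain ⟨c, hc⟩ := IsAlgClosed.exists_pow_nat_eq β⁻¹ hpos
  have hc0 : c ≠ 0 := by
    rintro rfl
    rw [zero_pow hpos.ne'] at hc
    exact inv_ne_zero hβ hc.symm
  have hm : p * q * m = p * q * n + p * q * (m - n) := by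
    rw [← mul_add, Nat.add_sub_cancel' hmn.le]
  have h := critForm_quasiHom hf hg (c := c) (e := 1) (β := 1) (β' := β)
    (by
      rw [hm, pow_add c, hc]
      field_simp
      simp) (p * (m - n)) (q * (m - n)) z u
  rw [hT] at h
  exact mul_ne_zero (pow_ne_zero 4 (mul_ne_zero (pow_ne_zero _ hc0) (by simp))) hne h.symm

theorem skewPoly_ne_zero (hp : 0 < p) (hq : 0 < q) (hn : 0 < n)
    (hg : IsQuasiHom q p (p * q * n) g)
    (hb₁ : coeff (Finsupp.single 0 (p * n)) g ≠ 0) (hb₂ : coeff (Finsupp.single 1 (q * n)) g ≠ 0)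
    (hfg : TorusNondegenerate f g) : skewPoly f g ≠ 0 := by
  intro h0
  obtain ⟨y, hy, hyg⟩ := hg.exists_root hp hq hn hb₁ hb₂
  have hk : eval ![1, y] f ≠ 0 := hfg.symm.not_both (by simp) (by simpa using hy) hyg
  obtain ⟨z, hz⟩ := exists_eval_ne_zero (φ := g) (by
    rintro rfl
    simp at hb₁)
  have h1 := eval_skewPoly f g z ![1, y]
  rw [h0, hyg, map_zero, map_zero, mul_zero, zero_sub] at h1
  exact neg_ne_zero.2 (mul_ne_zero ((map_ne_zero _).2 hk) hz) h1.symm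

end Nonvanishing

section Deformations

open MvPolynomial

theorem torusNondegenerate_of_isolated {q p D E : ℕ} {f g : MvPolynomial (Fin 2) ℂ}
    (hp : 0 < p) (hq : 0 < q) (hf : IsQuasiHom q p D f) (hg : IsQuasiHom q p E g)
    (hiso : ∃ ε : ℝ, 0 < ε ∧ ∀ w : Fin 2 → ℂ, w ≠ 0 → ‖w‖ < ε → ¬ IsSingularity
      (fun z => eval z f * (starRingEnd ℂ) (eval z g)) w) : TorusNondegenerate f g := by
  intro z h0 h1 hz
  obtain ⟨ε, hε, h⟩ := hiso
  obtain ⟨c, hc0, hc1, hcz⟩ : ∃ c : ℝ, 0 < c ∧ c ≤ 1 ∧ c * ‖z‖ < ε := by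
    refine ⟨min 1 (ε / (‖z‖ + 1)), by positivity, min_le_left _ _, ?_⟩
    calc min 1 (ε / (‖z‖ + 1)) * ‖z‖ ≤ ε / (‖z‖ + 1) * ‖z‖ := by
          gcongr
          exact min_le_right _ _
      _ < ε / (‖z‖ + 1) * (‖z‖ + 1) := by
          gcongr
          linarith
      _ = ε := by field_simp
  have hc : (c : ℂ) ≠ 0 := by exact_mod_cast hc0.ne'
  set w : Fin 2 → ℂ := ![(c : ℂ) ^ q * z 0, (c : ℂ) ^ p * z 1] with hw
  have hw0 : w 0 ≠ 0 := mul_ne_zero (pow_ne_zero _ hc) h0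
  have hw1 : w 1 ≠ 0 := mul_ne_zero (pow_ne_zero _ hc) h1
  have hbound : ∀ k, 0 < k → ∀ j, ‖(c : ℂ) ^ k * z j‖ ≤ c * ‖z‖ := by
    intro k hk j
    rw [norm_mul, norm_pow, Complex.norm_real, Real.norm_of_nonneg hc0.le]
    gcongr
    · exact pow_le_of_le_one hc0.le hc1 hk.ne'
    · exact norm_le_pi_norm z j
  refine h w (fun h => hw0 (by simp [h])) (lt_of_le_of_lt ?_ hcz) ?_
  · rw [pi_norm_le_iff_of_nonneg (by positivity)]
    intro j
    fin_cases j
    · exact hbound q hq 0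
    · exact hbound p hp 1
  have hfun : (fun z => eval z f * (starRingEnd ℂ) (eval z g)) =
      fun z => eval (withConj z) (deformation 0 0 f g 0 0) := by
    funext z
    simp [eval_deformation]
  rw [hfun]
  refine isSingularity_of_pderiv_eq_zero _ _ fun a => ?_
  have ha : withConj w a ≠ 0 := by
    rcases a with j | j <;> fin_cases j <;> simp [withConj, hw0, hw1]
  refine (mul_eq_zero.1 ?_).resolve_left ha
  have : withConj w a * eval (withConj w) (pderiv a (deformation 0 0 f g 0 0)) =
      eval (withConj w) (theta a (deformation 0 0 f g 0 0)) := by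
    simp [theta_apply]
  rw [this]
  obtain ⟨z00, z01⟩ := hz 0
  obtain ⟨z10, z11⟩ := hz 1
  rcases a with j | j <;> fin_cases j
  · simp [theta_inl_zero_deformation, eval_deformation, hw, hg.eval_smul, (hf.logDeriv _).eval_smul]
    simpa [or_comm, or_assoc, or_left_comm, hc, hc0.ne'] using z00
  · simp [theta_inl_one_deformation, eval_deformation, hw, hg.eval_smul, (hf.logDeriv _).eval_smul]
    simpa [or_comm, or_assoc, or_left_comm, hc, hc0.ne'] using z10
  · simp [theta_inr_deformation, eval_deformation, hw, hf.eval_smul, (hg.logDeriv _).eval_smul]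
    simpa [or_comm, or_assoc, or_left_comm, hc, hc0.ne'] using z01
  · simp [theta_inr_deformation, eval_deformation, hw, hf.eval_smul, (hg.logDeriv _).eval_smul]
    simpa [or_comm, or_assoc, or_left_comm, hc, hc0.ne'] using z11

theorem eq_linear_of_isQuasiHom {g : MvPolynomial (Fin 2) ℂ} (hg : IsQuasiHom 1 1 1 g) :
    g = C (coeff (Finsupp.single 0 1) g) * X 0 + C (coeff (Finsupp.single 1 1) g) * X 1 := by
  classical
  ext s
  rw [coeff_add, coeff_C_mul, coeff_C_mul, coeff_X, coeff_X]
  by_cases h0 : s = Finsupp.single 0 1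
  · subst h0
    simp [Finsupp.single_left_inj]
  by_cases h1 : s = Finsupp.single 1 1
  · subst h1
    simp [Finsupp.single_left_inj]
  rw [if_neg (Ne.symm h0), if_neg (Ne.symm h1), mul_zero, mul_zero, add_zero]
  by_contra hs
  have h2 := hg s hs
  rcases (show s 0 = 1 ∧ s 1 = 0 ∨ s 0 = 0 ∧ s 1 = 1 by omega) with ⟨h3, h4⟩ | ⟨h3, h4⟩
  · refine h0 (Finsupp.ext fun i => ?_)
    fin_cases i
    · simpa using h3
    · simpa using h4
  · refine h1 (Finsupp.ext fun i => ?_)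
    fin_cases i
    · simpa using h3
    · simpa using h4

/-- The coefficients `γ` for which `f ḡ + γ₁ z₁ ^ d₁ + γ₂ z₂ ^ d₂` satisfies the rank-one
condition with `β = 1` at `z`. -/
def critCoeff (d₁ d₂ : ℕ) (f g : MvPolynomial (Fin 2) ℂ) (z : Fin 2 → ℂ) : Fin 2 → ℂ :=
  ![((starRingEnd ℂ) (eval z f) * eval z (theta 0 g) -
      (starRingEnd ℂ) (eval z g) * eval z (theta 0 f)) / (d₁ * z 0 ^ d₁),
    ((starRingEnd ℂ) (eval z f) * eval z (theta 1 g) -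
      (starRingEnd ℂ) (eval z g) * eval z (theta 1 f)) / (d₂ * z 1 ^ d₂)]

theorem differentiable_eval_real (φ : MvPolynomial (Fin 2) ℂ) :
    Differentiable ℝ fun z : Fin 2 → ℂ => eval z φ := by
  intro z
  have := (hasFDerivAt_eval_withConj (rename Sum.inl φ) z).differentiableAt
  simpa only [eval_withConj_rename_inl] using this

theorem differentiable_conj_eval (φ : MvPolynomial (Fin 2) ℂ) :
    Differentiable ℝ fun z : Fin 2 → ℂ => (starRingEnd ℂ) (eval z φ) := by
  intro z
  have := (hasFDerivAt_eval_withConj (rename Sum.inr (map (starRingEnd ℂ) φ)) z).differentiableAt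
  simpa only [eval_withConj_rename_inr] using this

theorem differentiableOn_critCoeff {d₁ d₂ : ℕ} (hd₁ : 0 < d₁) (hd₂ : 0 < d₂)
    (f g : MvPolynomial (Fin 2) ℂ) :
    DifferentiableOn ℝ (critCoeff d₁ d₂ f g) {z | z 0 ≠ 0 ∧ z 1 ≠ 0} := by
  intro z hz
  refine DifferentiableAt.differentiableWithinAt ?_
  rw [differentiableAt_pi]
  intro j
  have h1 : (d₁ : ℂ) ≠ 0 := by exact_mod_cast hd₁.ne'
  have h2 : (d₂ : ℂ) ≠ 0 := by exact_mod_cast hd₂.ne'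
  have hnum : ∀ j, DifferentiableAt ℝ (fun z => (starRingEnd ℂ) (eval z f) * eval z (theta j g) -
      (starRingEnd ℂ) (eval z g) * eval z (theta j f)) z := fun j =>
    ((differentiable_conj_eval f z).mul (differentiable_eval_real _ z)).sub
      ((differentiable_conj_eval g z).mul (differentiable_eval_real _ z))
  have hden : ∀ (d : ℕ) (j : Fin 2),
      DifferentiableAt ℝ (fun z : Fin 2 → ℂ => (d : ℂ) * z j ^ d) z := fun d j => by fun_prop
  have hinv : ∀ {φ : (Fin 2 → ℂ) → ℂ}, DifferentiableAt ℝ φ z → φ z ≠ 0 →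
      DifferentiableAt ℝ (fun z => (φ z)⁻¹) z := fun hφ h0 =>
    ((differentiableAt_inv (𝕜 := ℂ) h0).restrictScalars ℝ).comp z hφ
  fin_cases j
  · simp only [critCoeff, div_eq_mul_inv]
    exact (hnum 0).mul (hinv (hden d₁ 0) (mul_ne_zero h1 (pow_ne_zero _ hz.1)))
  · simp only [critCoeff, div_eq_mul_inv]
    exact (hnum 1).mul (hinv (hden d₂ 1) (mul_ne_zero h2 (pow_ne_zero _ hz.2)))

theorem exists_coeff_notMem {A : Fin 2 → ℂ} (hA : ∀ j, A j ≠ 0) {d₁ d₂ : ℕ} (hd₁ : 0 < d₁)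
    (hd₂ : 0 < d₂) (f g : MvPolynomial (Fin 2) ℂ) {T : MvPolynomial (Fin 2 ⊕ Fin 2) ℂ}
    (hT : T ≠ 0) :
    ∃ γ : Fin 2 → ℂ, (∀ j, 0 < (A j * γ j).re) ∧
      ∀ z : Fin 2 → ℂ, z 0 ≠ 0 → z 1 ≠ 0 → critCoeff d₁ d₂ f g z = γ →
        eval (withConj z) T ≠ 0 := by
  set Z : Set (Fin 2 → ℂ) := {z | (z 0 ≠ 0 ∧ z 1 ≠ 0) ∧ eval (withConj z) T = 0}
  have hZ : MeasureTheory.volume (critCoeff d₁ d₂ f g '' Z) = 0 := by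
    refine MeasureTheory.addHaar_image_eq_zero_of_differentiableOn_of_addHaar_eq_zero _
      ((differentiableOn_critCoeff hd₁ hd₂ f g).mono fun z hz => hz.1) ?_
    exact MeasureTheory.measure_mono_null (fun z hz => hz.2) (volume_eval_withConj_eq_zero hT)
  set V : Set (Fin 2 → ℂ) := {γ | ∀ j, 0 < (A j * γ j).re}
  have hV : IsOpen V := by
    simp only [V, Set.ofPred_forall]
    exact isOpen_iInter_of_finite fun j => isOpen_lt continuous_const (by fun_prop)
  have hne : V.Nonempty := by
    refine ⟨fun j => (starRingEnd ℂ) (A j), fun j => ?_⟩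
    rw [mul_conj, ofReal_re]
    exact normSq_pos.2 (hA j)
  obtain ⟨γ, hγ, hγ'⟩ : ∃ γ ∈ V, γ ∉ critCoeff d₁ d₂ f g '' Z := by
    by_contra! hcon
    exact hV.measure_ne_zero MeasureTheory.volume hne (MeasureTheory.measure_mono_null hcon hZ)
  exact ⟨γ, hγ, fun z h0 h1 hz hTz => hγ' ⟨z, ⟨⟨h0, h1⟩, hTz⟩, hz⟩⟩

theorem exists_scale {β : ℂ} (hβ : ‖β‖ = 1) {t : ℝ} (ht : 0 < t) {N k : ℕ} (hN : 0 < N)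
    (hk : 0 < k) :
    ∃ c : ℂ, c ≠ 0 ∧ (starRingEnd ℂ) c ^ N = β * c ^ N ∧
      t * (c ^ k * (starRingEnd ℂ) c ^ k) = 1 := by
  obtain ⟨x, hx⟩ := IsAlgClosed.exists_pow_nat_eq β (Nat.mul_pos two_pos hN)
  have hx1 : ‖x‖ = 1 := by
    rw [← pow_eq_one_iff_of_nonneg (norm_nonneg x) (Nat.mul_pos two_pos hN).ne', ← norm_pow, hx, hβ]
  have hxx : (starRingEnd ℂ) x * x = 1 := by
    rw [mul_comm, mul_conj, normSq_eq_norm_sq, hx1]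
    norm_num
  set r : ℝ := t⁻¹ ^ ((2 * k : ℕ) : ℝ)⁻¹
  have hr : r ^ (2 * k) = t⁻¹ := Real.rpow_inv_natCast_pow (by positivity) (by omega)
  have hr0 : 0 < r := Real.rpow_pos_of_pos (by positivity) _
  refine ⟨r * (starRingEnd ℂ) x, mul_ne_zero (by exact_mod_cast hr0.ne')
    (left_ne_zero_of_mul_eq_one hxx), ?_, ?_⟩
  · have h1 : ((starRingEnd ℂ) x * x) ^ N = 1 := by rw [hxx, one_pow]
    rw [← hx, map_mul, conj_ofReal, conj_conj, mul_pow, mul_pow, two_mul, pow_add]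
    rw [mul_pow] at h1
    linear_combination -(r : ℂ) ^ N * x ^ N * h1
  · have h1 : ((starRingEnd ℂ) x * x) ^ k = 1 := by rw [hxx, one_pow]
    have h2 : (t : ℂ) * (r : ℂ) ^ (2 * k) = 1 := by
      rw [← ofReal_pow, hr, ← ofReal_mul, mul_inv_cancel₀ ht.ne', ofReal_one]
    rw [map_mul, conj_ofReal, conj_conj, mul_pow, mul_pow]
    rw [mul_pow] at h1
    rw [two_mul, pow_add] at h2
    linear_combination (t : ℂ) * (r : ℂ) ^ k * (r : ℂ) ^ k * h1 + h2

theorem axis_ne {a b γ β y : ℂ} {e m n : ℕ} {t : ℝ} (he : 0 < e) (hmn : n < m)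
    (hβ : ‖β‖ = 1) (hy : y ≠ 0) (ht : 0 < t) (hγ : 0 < ((starRingEnd ℂ) a * b * γ).re) :
    β * (starRingEnd ℂ) (a * y ^ (e * m)) * ((e * n : ℕ) * b * y ^ (e * n)) ≠
      (starRingEnd ℂ) (b * y ^ (e * n)) * ((e * m : ℕ) * a * y ^ (e * m)) +
        (e * (m - n) : ℕ) * (t * γ) * y ^ (e * (m - n)) := by
  intro h
  obtain ⟨d, rfl⟩ := Nat.exists_eq_add_of_lt hmn
  have hd : n + d + 1 - n = d + 1 := by omega
  rw [hd] at h
  set A : ℂ := (starRingEnd ℂ) a * b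
  set ρ : ℝ := normSq (y ^ (e * n))
  set Y : ℂ := y ^ (e * (d + 1)) with hY
  set E : ℂ := (n + d + 1) * (starRingEnd ℂ) A * ρ + (d + 1) * (t * γ)
  have hρ : (ρ : ℂ) = (starRingEnd ℂ) (y ^ (e * n)) * y ^ (e * n) := normSq_eq_conj_mul_self
  have hsplit : y ^ (e * (n + d + 1)) = y ^ (e * n) * Y := by
    rw [hY, ← pow_add]
    congr 1
    ring
  have he' : (e : ℂ) ≠ 0 := by exact_mod_cast he.ne'
  have h1 : β * (starRingEnd ℂ) Y * (n * A * ρ) = Y * E := by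
    refine mul_left_cancel₀ he' ?_
    simp only [hsplit, map_mul, Nat.cast_mul, Nat.cast_add, Nat.cast_one] at h
    simp only [E, A, hρ, map_mul, conj_conj]
    linear_combination h
  have h2 : ‖(n * A * ρ : ℂ)‖ = ‖E‖ := by
    have h3 := congrArg norm h1
    rw [norm_mul, norm_mul, hβ, one_mul, RCLike.norm_conj, norm_mul Y] at h3
    exact mul_left_cancel₀ (norm_ne_zero_iff.2 (pow_ne_zero _ hy)) h3
  have h4 : (A * E).re = (n + d + 1) * (‖A‖ ^ 2 * ρ) + (d + 1) * t * (A * γ).re := by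
    have : A * E = (((n + d + 1) * (normSq A * ρ) : ℝ) : ℂ) +
        (((d + 1) * t : ℝ) : ℂ) * (A * γ) := by
      push_cast
      rw [← mul_conj]
      ring
    rw [this, add_re, ofReal_re, re_ofReal_mul, normSq_eq_norm_sq]
  have h5 : ‖A * E‖ = n * (‖A‖ ^ 2 * ρ) := by
    rw [norm_mul A, ← h2, norm_mul _ (ρ : ℂ), norm_mul _ A, Complex.norm_natCast, Complex.norm_real,
      Real.norm_of_nonneg (normSq_nonneg _)]
    ring
  have h6 := re_le_norm (A * E)
  have h7 : 0 ≤ (d + 1) * (‖A‖ ^ 2 * ρ) := mul_nonneg (by positivity)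
    (mul_nonneg (by positivity) (normSq_nonneg _))
  have h8 : 0 < (d + 1) * t * (A * γ).re := by positivity
  rw [h4, h5] at h6
  linarith

theorem theta_deformation_relations {d₁ d₂ : ℕ} {f g : MvPolynomial (Fin 2) ℂ} {c₁ c₂ : ℂ}
    {w : Fin 2 → ℂ}
    (h : rankAt (fun z => eval (withConj z) (deformation d₁ d₂ f g c₁ c₂)) w = 1) :
    ∃ β : ℂ, ‖β‖ = 1 ∧
      β * (starRingEnd ℂ) (eval w f) * eval w (theta 0 g) =
        (starRingEnd ℂ) (eval w g) * eval w (theta 0 f) + d₁ * c₁ * w 0 ^ d₁ ∧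
      β * (starRingEnd ℂ) (eval w f) * eval w (theta 1 g) =
        (starRingEnd ℂ) (eval w g) * eval w (theta 1 f) + d₂ * c₂ * w 1 ^ d₂ := by
  obtain ⟨β, hβ, hrel⟩ := exists_unit_of_rankAt_eq_one _ _ h
  have key : ∀ j, β * (starRingEnd ℂ)
      (eval (withConj w) (theta (.inr j) (deformation d₁ d₂ f g c₁ c₂))) =
      eval (withConj w) (theta (.inl j) (deformation d₁ d₂ f g c₁ c₂)) := by
    intro j
    simp only [theta_apply, map_mul, eval_X, ← hrel j]
    simp only [withConj, conj_conj, Sum.elim_inl, Sum.elim_inr]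
    ring
  have k0 := key 0
  have k1 := key 1
  rw [theta_inr_deformation, theta_inl_zero_deformation, eval_deformation, eval_deformation] at k0
  rw [theta_inr_deformation, theta_inl_one_deformation, eval_deformation, eval_deformation] at k1
  simp only [map_mul, conj_conj, zero_mul, add_zero, zero_add] at k0 k1
  exact ⟨β, hβ, by linear_combination k0, by linear_combination k1⟩

theorem pderiv_inr_deformation (j : Fin 2) (d₁ d₂ : ℕ) (f g : MvPolynomial (Fin 2) ℂ) (c₁ c₂ : ℂ)
    (w : Fin 2 → ℂ) :
    eval (withConj w) (pderiv (.inr j) (deformation d₁ d₂ f g c₁ c₂)) =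
      eval w f * (starRingEnd ℂ) (eval w (pderiv j g)) := by
  have h1 : pderiv (Sum.inr j) (rename (Sum.inl : Fin 2 → Fin 2 ⊕ Fin 2) f) = 0 := by
    refine pderiv_eq_zero_of_notMem_vars fun hj => ?_
    obtain ⟨i, -, hi⟩ := mem_vars_rename _ _ hj
    exact Sum.inl_ne_inr hi
  have h2 : pderiv (Sum.inr j) (rename (Sum.inr : Fin 2 → Fin 2 ⊕ Fin 2)
      (map (starRingEnd ℂ) g)) = rename Sum.inr (map (starRingEnd ℂ) (pderiv j g)) := by
    rw [pderiv_rename Sum.inr_injective, pderiv_map]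
  simp [deformation, h1, h2, Derivation.leibniz, Derivation.leibniz_pow, pderiv_X,
    eval_withConj_rename_inl, eval_withConj_rename_inr]

theorem eval_ne_zero_of_rankAt_eq_one {d₁ d₂ : ℕ} {f g : MvPolynomial (Fin 2) ℂ} {c₁ c₂ : ℂ}
    {w : Fin 2 → ℂ}
    (h : rankAt (fun z => eval (withConj z) (deformation d₁ d₂ f g c₁ c₂)) w = 1) :
    eval w f ≠ 0 := by
  intro hf
  obtain ⟨β, -, hrel⟩ := exists_unit_of_rankAt_eq_one _ _ h
  have h0 : ∀ j, eval (withConj w) (pderiv (.inr j) (deformation d₁ d₂ f g c₁ c₂)) = 0 := by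
    intro j
    rw [pderiv_inr_deformation, hf, zero_mul]
  rw [rankAt_eq_zero] at h
  · exact zero_ne_one h
  · rintro (j | j)
    · rw [← hrel j, h0, map_zero, mul_zero]
    · exact h0 j

variable {p q m n : ℕ} {f g : MvPolynomial (Fin 2) ℂ}

theorem critForm_ne_zero_and_skew_ne_zero (hp : 0 < p) (hq : 0 < q) (hn : 0 < n) (hmn : n < m)
    (hf : IsQuasiHom q p (p * q * m) f) (hg : IsQuasiHom q p (p * q * n) g) {γ : Fin 2 → ℂ}
    (hγ : ∀ z : Fin 2 → ℂ, z 0 ≠ 0 → z 1 ≠ 0 →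
      critCoeff (p * (m - n)) (q * (m - n)) f g z = γ →
        eval (withConj z) (critFormPoly (p * (m - n)) (q * (m - n)) f g * skewPoly f g) ≠ 0)
    {t : ℝ} (ht : 0 < t) {β : ℂ} (hβ : ‖β‖ = 1) {w : Fin 2 → ℂ} (hw0 : w 0 ≠ 0) (hw1 : w 1 ≠ 0)
    (h0 : β * (starRingEnd ℂ) (eval w f) * eval w (theta 0 g) =
      (starRingEnd ℂ) (eval w g) * eval w (theta 0 f) +
        (p * (m - n) : ℕ) * (t * γ 0) * w 0 ^ (p * (m - n)))
    (h1 : β * (starRingEnd ℂ) (eval w f) * eval w (theta 1 g) =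
      (starRingEnd ℂ) (eval w g) * eval w (theta 1 f) +
        (q * (m - n) : ℕ) * (t * γ 1) * w 1 ^ (q * (m - n))) :
    critForm (p * (m - n)) (q * (m - n)) f g β w w ≠ 0 ∧
      eval w f * (starRingEnd ℂ) (eval w g) - β * (starRingEnd ℂ) (eval w f) * eval w g ≠ 0 := by
  have hk : 0 < m - n := Nat.sub_pos_of_lt hmn
  obtain ⟨c, hc, hcN, hck⟩ := exists_scale hβ ht (Nat.mul_pos (Nat.mul_pos hp hq) hk)
    (Nat.mul_pos (Nat.mul_pos hp hq) hn)
  have hM : p * q * m = p * q * (m - n) + p * q * n := by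
    rw [← Nat.mul_add, Nat.sub_add_cancel hmn.le]
  have hd0 : ((p * (m - n) : ℕ) : ℂ) ≠ 0 := by exact_mod_cast (Nat.mul_pos hp hk).ne'
  have hd1 : ((q * (m - n) : ℕ) : ℂ) ≠ 0 := by exact_mod_cast (Nat.mul_pos hq hk).ne'
  have hcβ : (1 : ℂ) * ((starRingEnd ℂ) c ^ (p * q * m) * c ^ (p * q * n)) =
      β * (c ^ (p * q * m) * (starRingEnd ℂ) c ^ (p * q * n)) := by
    rw [hM, pow_add, pow_add, hcN]
    ring
  set v : Fin 2 → ℂ := ![c ^ q * w 0, c ^ p * w 1] with hv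
  have hv0 : v 0 ≠ 0 := mul_ne_zero (pow_ne_zero _ hc) hw0
  have hv1 : v 1 ≠ 0 := mul_ne_zero (pow_ne_zero _ hc) hw1
  have hcrit : critCoeff (p * (m - n)) (q * (m - n)) f g v = γ := by
    funext j
    fin_cases j
    · have : ((p * (m - n) : ℕ) : ℂ) * v 0 ^ (p * (m - n)) ≠ 0 :=
        mul_ne_zero hd0 (pow_ne_zero _ hv0)
      refine (div_eq_iff this).2 ?_
      change _ = γ 0 * _
      rw [hv, hf.eval_smul, hg.eval_smul, (hf.logDeriv 0).eval_smul, (hg.logDeriv 0).eval_smul, hM]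
      simp only [Matrix.cons_val_zero, map_mul, map_pow, mul_pow, ← pow_mul, pow_add,
        show q * (p * (m - n)) = p * q * (m - n) by ring, hcN]
      linear_combination c ^ (p * q * (m - n)) * (c ^ (p * q * n) * (starRingEnd ℂ) c ^ (p * q * n))
        * h0 + c ^ (p * q * (m - n)) * (p * (m - n) : ℕ) * γ 0 * w 0 ^ (p * (m - n)) * hck
    · have : ((q * (m - n) : ℕ) : ℂ) * v 1 ^ (q * (m - n)) ≠ 0 :=
        mul_ne_zero hd1 (pow_ne_zero _ hv1)
      refine (div_eq_iff this).2 ?_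
      change _ = γ 1 * _
      rw [hv, hf.eval_smul, hg.eval_smul, (hf.logDeriv 1).eval_smul, (hg.logDeriv 1).eval_smul, hM]
      simp only [Matrix.cons_val_one, Matrix.cons_val_fin_one, map_mul, map_pow, mul_pow, ← pow_mul,
        pow_add, show p * (q * (m - n)) = p * q * (m - n) by ring, hcN]
      linear_combination c ^ (p * q * (m - n)) * (c ^ (p * q * n) * (starRingEnd ℂ) c ^ (p * q * n))
        * h1 + c ^ (p * q * (m - n)) * (q * (m - n) : ℕ) * γ 1 * w 1 ^ (q * (m - n)) * hck
  have hne := hγ v hv0 hv1 hcrit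
  rw [map_mul] at hne
  have hform : eval (withConj v) (critFormPoly (p * (m - n)) (q * (m - n)) f g) = _ :=
    eval_critFormPoly _ _ f g v v
  have hskew : eval (withConj v) (skewPoly f g) = _ := eval_skewPoly f g v v
  rw [hform, hskew, hv, critForm_quasiHom hf hg hcβ, hf.eval_smul, hg.eval_smul] at hne
  refine ⟨fun h => left_ne_zero_of_mul hne (by rw [h, mul_zero]), fun h => ?_⟩
  refine right_ne_zero_of_mul hne ?_
  simp only [map_mul, map_pow]
  linear_combination c ^ (p * q * m) * (starRingEnd ℂ) c ^ (p * q * n) * h -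
    (starRingEnd ℂ) (eval w f) * eval w g * hcβ

theorem ne_zero_zero_of_relation (hp : 0 < p) (hq : 0 < q) (hmn : n < m)
    (hf : IsQuasiHom q p (p * q * m) f) (hg : IsQuasiHom q p (p * q * n) g) {γ β : ℂ} {t : ℝ}
    (hγ : 0 < ((starRingEnd ℂ) (coeff (Finsupp.single 1 (q * m)) f) *
      coeff (Finsupp.single 1 (q * n)) g * γ).re)
    (ht : 0 < t) (hβ : ‖β‖ = 1) {w : Fin 2 → ℂ} (hw : eval w f ≠ 0) (hm : 0 < m)
    (h : β * (starRingEnd ℂ) (eval w f) * eval w (theta 1 g) =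
      (starRingEnd ℂ) (eval w g) * eval w (theta 1 f) +
        (q * (m - n) : ℕ) * (t * γ) * w 1 ^ (q * (m - n))) : w 0 ≠ 0 := by
  intro h0
  have hwe : w = ![0, w 1] := by
    funext j
    fin_cases j
    · exact h0
    · rfl
  rw [mul_assoc] at hf hg
  rw [hwe] at hw h
  rw [hf.eval_zero_left hp] at hw
  have hy : w 1 ≠ 0 := fun h1 => hw (by rw [h1, zero_pow (Nat.mul_pos hq hm).ne', mul_zero])
  rw [hf.eval_zero_left hp, hg.eval_zero_left hp, (hf.logDeriv 1).eval_zero_left hp,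
    (hg.logDeriv 1).eval_zero_left hp, coeff_theta, coeff_theta] at h
  simp only [Finsupp.single_eq_same] at h
  exact axis_ne hq hmn hβ hy ht hγ h

theorem ne_zero_one_of_relation (hp : 0 < p) (hq : 0 < q) (hmn : n < m)
    (hf : IsQuasiHom q p (p * q * m) f) (hg : IsQuasiHom q p (p * q * n) g) {γ β : ℂ} {t : ℝ}
    (hγ : 0 < ((starRingEnd ℂ) (coeff (Finsupp.single 0 (p * m)) f) *
      coeff (Finsupp.single 0 (p * n)) g * γ).re)
    (ht : 0 < t) (hβ : ‖β‖ = 1) {w : Fin 2 → ℂ} (hw : eval w f ≠ 0) (hm : 0 < m)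
    (h : β * (starRingEnd ℂ) (eval w f) * eval w (theta 0 g) =
      (starRingEnd ℂ) (eval w g) * eval w (theta 0 f) +
        (p * (m - n) : ℕ) * (t * γ) * w 0 ^ (p * (m - n))) : w 1 ≠ 0 := by
  intro h1
  have hwe : w = ![w 0, 0] := by
    funext j
    fin_cases j
    · rfl
    · exact h1
  rw [mul_comm p, mul_assoc] at hf hg
  rw [hwe] at hw h
  rw [hf.eval_zero_right hq] at hw
  have hy : w 0 ≠ 0 := fun h0 => hw (by rw [h0, zero_pow (Nat.mul_pos hp hm).ne', mul_zero])
  rw [hf.eval_zero_right hq, hg.eval_zero_right hq, (hf.logDeriv 0).eval_zero_right hq,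
    (hg.logDeriv 0).eval_zero_right hq, coeff_theta, coeff_theta] at h
  simp only [Finsupp.single_eq_same] at h
  exact axis_ne hp hmn hβ hy ht hγ h

theorem det_mixedHessian_ne_zero_and_eval_ne_zero (hp : 0 < p) (hq : 0 < q) (hn : 0 < n)
    (hmn : n < m)
    (hf : IsQuasiHom q p (p * q * m) f) (hg : IsQuasiHom q p (p * q * n) g) {γ : Fin 2 → ℂ}
    (hγ₁ : 0 < ((starRingEnd ℂ) (coeff (Finsupp.single 0 (p * m)) f) *
      coeff (Finsupp.single 0 (p * n)) g * γ 0).re)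
    (hγ₂ : 0 < ((starRingEnd ℂ) (coeff (Finsupp.single 1 (q * m)) f) *
      coeff (Finsupp.single 1 (q * n)) g * γ 1).re)
    (hγ : ∀ z : Fin 2 → ℂ, z 0 ≠ 0 → z 1 ≠ 0 →
      critCoeff (p * (m - n)) (q * (m - n)) f g z = γ →
        eval (withConj z) (critFormPoly (p * (m - n)) (q * (m - n)) f g * skewPoly f g) ≠ 0)
    {t : ℝ} (ht : 0 < t) {w : Fin 2 → ℂ}
    (h : rankAt (fun z => eval (withConj z)
      (deformation (p * (m - n)) (q * (m - n)) f g (t * γ 0) (t * γ 1))) w = 1) :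
    (mixedHessian (fun z => eval (withConj z)
      (deformation (p * (m - n)) (q * (m - n)) f g (t * γ 0) (t * γ 1))) w).det ≠ 0 ∧
    eval (withConj w) (deformation (p * (m - n)) (q * (m - n)) f g (t * γ 0) (t * γ 1)) ≠ 0 := by
  have hw := eval_ne_zero_of_rankAt_eq_one h
  obtain ⟨β, hβ, h0, h1⟩ := theta_deformation_relations h
  have hw0 := ne_zero_zero_of_relation hp hq hmn hf hg hγ₂ ht hβ hw (hn.trans hmn) h1
  have hw1 := ne_zero_one_of_relation hp hq hmn hf hg hγ₁ ht hβ hw (hn.trans hmn) h0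
  obtain ⟨hcrit, hskew⟩ :=
    critForm_ne_zero_and_skew_ne_zero hp hq hn hmn hf hg hγ ht hβ hw0 hw1 h0 h1
  refine ⟨fun hdet => hcrit ?_, fun hzero => hskew ?_⟩
  · rw [← det_mixedHessian_deformation _ _ _ _ _ _ β w h0 h1, hdet, mul_zero]
  · rw [eval_deformation] at hzero
    have e1 := hf.euler_eval w
    have e2 := hg.euler_eval w
    have hne : (p * q * n : ℂ) ≠ 0 := by
      exact_mod_cast (Nat.mul_pos (Nat.mul_pos hp hq) hn).ne'
    refine (mul_eq_zero.1 ?_).resolve_left hne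
    push_cast [Nat.cast_sub hmn.le] at h0 h1 e1 e2
    linear_combination (-q : ℂ) * h0 - p * h1 - (starRingEnd ℂ) (eval w g) * e1 +
      β * (starRingEnd ℂ) (eval w f) * e2 - p * q * (m - n) * hzero

end Deformations

theorem ne_zero_of_re_mul_pos {A γ : ℂ} (h : 0 < (A * γ).re) : γ ≠ 0 := by
  rintro rfl
  simp at h

theorem re_div_conj_pos {A γ : ℂ} (h : 0 < (A * γ).re) : 0 < (A / (starRingEnd ℂ) γ).re := by
  have hγ := normSq_pos.2 (ne_zero_of_re_mul_pos h)
  have : A / (starRingEnd ℂ) γ = (((normSq γ)⁻¹ : ℝ) : ℂ) * (A * γ) := by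
    rw [div_eq_mul_inv, inv_def, conj_conj, normSq_conj]
    ring
  rw [this, re_ofReal_mul]
  positivity

/-- If `g` is not linear, there are coefficients `γ₁, γ₂` with
`Re(conj(a_j)·b_j/conj(γ_j)) > 0` such that for all small `t > 0`, on the rank-one
singular set of `F_t = fḡ + t·(γ₁z₁^{p(m−n)} + γ₂z₂^{q(m−n)})` the mixed Hessian
determinant and `F_t` itself are nonzero. -/
theorem stmt_13
    (p q m n : ℕ) (hp : 0 < p) (hq : 0 < q) (hm : 0 < m) (hn : 0 < n)
    (hmn : n < m) (hpq : p ≤ q)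
    (f g : MvPolynomial (Fin 2) ℂ)
    (hf : ∀ c : ℂ, c ≠ 0 → ∀ z : Fin 2 → ℂ,
      MvPolynomial.eval ![c ^ q * z 0, c ^ p * z 1] f =
        c ^ (p * q * m) * MvPolynomial.eval z f)
    (hg : ∀ c : ℂ, c ≠ 0 → ∀ z : Fin 2 → ℂ,
      MvPolynomial.eval ![c ^ q * z 0, c ^ p * z 1] g =
        c ^ (p * q * n) * MvPolynomial.eval z g)
    (a₁ a₂ b₁ b₂ : ℂ)
    (ha₁def : a₁ = MvPolynomial.coeff (Finsupp.single 0 (p * m)) f) (ha₁ : a₁ ≠ 0)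
    (ha₂def : a₂ = MvPolynomial.coeff (Finsupp.single 1 (q * m)) f) (ha₂ : a₂ ≠ 0)
    (hb₁def : b₁ = MvPolynomial.coeff (Finsupp.single 0 (p * n)) g) (hb₁ : b₁ ≠ 0)
    (hb₂def : b₂ = MvPolynomial.coeff (Finsupp.single 1 (q * n)) g) (hb₂ : b₂ ≠ 0)
    (hsing0 : IsSingularity
      (fun z => MvPolynomial.eval z f * (starRingEnd ℂ) (MvPolynomial.eval z g)) 0)
    (hiso : ∃ ε : ℝ, 0 < ε ∧ ∀ w : Fin 2 → ℂ, w ≠ 0 → ‖w‖ < ε → ¬ IsSingularity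
      (fun z => MvPolynomial.eval z f * (starRingEnd ℂ) (MvPolynomial.eval z g)) w)
    (hglin : ¬ ∃ β₁ β₂ : ℂ, g = MvPolynomial.C β₁ * MvPolynomial.X 0 +
      MvPolynomial.C β₂ * MvPolynomial.X 1) :
    ∃ γ₁ γ₂ : ℂ, γ₁ ≠ 0 ∧ γ₂ ≠ 0 ∧
      0 < ((starRingEnd ℂ) a₁ * b₁ / (starRingEnd ℂ) γ₁).re ∧
      0 < ((starRingEnd ℂ) a₂ * b₂ / (starRingEnd ℂ) γ₂).re ∧
      ∃ t₀ : ℝ, 0 < t₀ ∧ ∀ t : ℝ, 0 < t → t < t₀ →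
        ∀ w : Fin 2 → ℂ,
          rankAt (fun z =>
            MvPolynomial.eval z f * (starRingEnd ℂ) (MvPolynomial.eval z g) +
              (t : ℂ) * (γ₁ * z 0 ^ (p * (m - n)) + γ₂ * z 1 ^ (q * (m - n)))) w = 1 →
          (mixedHessian (fun z =>
            MvPolynomial.eval z f * (starRingEnd ℂ) (MvPolynomial.eval z g) +
              (t : ℂ) * (γ₁ * z 0 ^ (p * (m - n)) + γ₂ * z 1 ^ (q * (m - n)))) w).det ≠ 0 ∧
          MvPolynomial.eval w f * (starRingEnd ℂ) (MvPolynomial.eval w g) +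
            (t : ℂ) * (γ₁ * w 0 ^ (p * (m - n)) + γ₂ * w 1 ^ (q * (m - n))) ≠ 0 := by
  subst ha₁def ha₂def hb₁def hb₂def
  have hf' := isQuasiHom_of_eval hf
  have hg' := isQuasiHom_of_eval hg
  have hfg : TorusNondegenerate f g := torusNondegenerate_of_isolated hp hq hf' hg' hiso
  have hk : 0 < m - n := Nat.sub_pos_of_lt hmn
  have hN : q = 1 → 2 ≤ n := by
    rintro rfl
    obtain rfl : p = 1 := by omega
    by_contra hlt
    obtain rfl : n = 1 := by omega
    exact hglin ⟨_, _, eq_linear_of_isQuasiHom hg'⟩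
  have hA : ∀ j, (![(starRingEnd ℂ) (MvPolynomial.coeff (Finsupp.single 0 (p * m)) f) *
        MvPolynomial.coeff (Finsupp.single 0 (p * n)) g,
      (starRingEnd ℂ) (MvPolynomial.coeff (Finsupp.single 1 (q * m)) f) *
        MvPolynomial.coeff (Finsupp.single 1 (q * n)) g] : Fin 2 → ℂ) j ≠ 0 := by
    intro j
    fin_cases j
    · exact mul_ne_zero ((map_ne_zero _).2 ha₁) hb₁
    · exact mul_ne_zero ((map_ne_zero _).2 ha₂) hb₂
  obtain ⟨γ, hγ, hT⟩ := exists_coeff_notMem hA (Nat.mul_pos hp hk) (Nat.mul_pos hq hk) f g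
    (mul_ne_zero (critFormPoly_ne_zero hp hn hmn hpq hN hf' hg' ha₁ ha₂ hb₁ hb₂ hfg)
      (skewPoly_ne_zero hp hq hn hg' hb₁ hb₂ hfg))
  refine ⟨γ 0, γ 1, ne_zero_of_re_mul_pos (hγ 0), ne_zero_of_re_mul_pos (hγ 1),
    re_div_conj_pos (hγ 0), re_div_conj_pos (hγ 1), 1, one_pos, fun t ht _ w hw => ?_⟩
  have hF : ∀ z : Fin 2 → ℂ,
      MvPolynomial.eval z f * (starRingEnd ℂ) (MvPolynomial.eval z g) +
          (t : ℂ) * (γ 0 * z 0 ^ (p * (m - n)) + γ 1 * z 1 ^ (q * (m - n))) =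
        MvPolynomial.eval (withConj z)
          (deformation (p * (m - n)) (q * (m - n)) f g (t * γ 0) (t * γ 1)) := by
    intro z
    rw [eval_deformation]
    ring
  simp only [hF] at hw ⊢
  exact det_mixedHessian_ne_zero_and_eval_ne_zero hp hq hn hmn hf' hg' (hγ 0) (hγ 1) hT ht hw

end
end
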